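/- arXiv:math/0010163 — 2 statements merged into one kernel-verified Lean document; each statement's English description precedes it below -/
import Mathlib

section
/- Let X = {f = 0} ⊂ ℙ³(ℂ) be a surface of degree 6 whose only singularities are ordinary triple points. Then any plane H ⊂ ℙ³(ℂ) contains at most five of the triple points of X; and if a plane H contains five triple points, then the restriction of f to H (that is, the ternary sextic obtained by composing f with a linear isomorphism ℙ² ≅ H) equals λ q³ for some λ ∈ ℂ∖{0} and some nondegenerate quadratic form q in three variables vanishing at the five points, so that H·X = 3C for a smooth conic C. -/
open MvPolynomial

noncomputable section

/-- Iterated partial derivative of `f` along a list of variable indices. -/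
def pderivList {n : ℕ} (l : List (Fin n)) (f : MvPolynomial (Fin n) ℂ) :
    MvPolynomial (Fin n) ℂ :=
  l.foldl (fun g i => MvPolynomial.pderiv i g) f

/-- All partial derivatives of `f` of order `< m` vanish at `p`
(`P` has multiplicity `≥ m` on `{f = 0}`). -/
def MultAtLeast {n : ℕ} (f : MvPolynomial (Fin n) ℂ) (p : Fin n → ℂ) (m : ℕ) : Prop :=
  ∀ l : List (Fin n), l.length < m → MvPolynomial.eval p (pderivList l f) = 0

/-- `p` is (a representative of) a singular point of `{f = 0}`. -/
def SingularAt (f : MvPolynomial (Fin 4) ℂ) (p : Fin 4 → ℂ) : Prop :=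
  MultAtLeast f p 2

/-- The partial derivatives of `c` have no common zero in `ℂⁿ ∖ {0}`. -/
def NowhereSingular {n : ℕ} (c : MvPolynomial (Fin n) ℂ) : Prop :=
  ∀ p : Fin n → ℂ, p ≠ 0 → ∃ i, MvPolynomial.eval p (MvPolynomial.pderiv i c) ≠ 0

/-- Linear change of coordinates: `substMatrix B f` is the polynomial `x ↦ f (B.mulVec x)`. -/
def substMatrix {n : ℕ} (B : Matrix (Fin n) (Fin n) ℂ) (f : MvPolynomial (Fin n) ℂ) :
    MvPolynomial (Fin n) ℂ :=
  MvPolynomial.aeval (fun i => ∑ j, MvPolynomial.C (B i j) * MvPolynomial.X j) f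

/-- `p` is (a representative of) an ordinary triple point of the degree-`d` surface `{f = 0}`:
all partials of order `≤ 2` vanish at `p`, some third-order partial does not, and after a
linear change of coordinates taking `(0,0,0,1)` to `p`, writing `f` as
`∑ⱼ x₃^(d-j) fⱼ(x₀,x₁,x₂)` with `fⱼ` homogeneous of degree `j`, the cubic `f₃` is nonsingular. -/
def OrdinaryTriplePointAt (d : ℕ) (f : MvPolynomial (Fin 4) ℂ) (p : Fin 4 → ℂ) : Prop :=
  MultAtLeast f p 3 ∧
  (∃ l : List (Fin 4), l.length = 3 ∧ MvPolynomial.eval p (pderivList l f) ≠ 0) ∧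
  ∃ B : Matrix (Fin 4) (Fin 4) ℂ, IsUnit B.det ∧ B.mulVec ![0, 0, 0, 1] = p ∧
    ∃ g : ℕ → MvPolynomial (Fin 3) ℂ,
      (∀ j, (g j).IsHomogeneous j) ∧
      substMatrix B f =
        ∑ j ∈ Finset.range (d + 1),
          (MvPolynomial.X 3) ^ (d - j) * MvPolynomial.rename Fin.castSucc (g j) ∧
      NowhereSingular (g 3)

/-- The set of singular points of `{f = 0}` in `ℙ³(ℂ)`. -/
def SingSet (f : MvPolynomial (Fin 4) ℂ) : Set (Projectivization ℂ (Fin 4 → ℂ)) :=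
  {P | SingularAt f P.rep}

/-- `{f = 0}` has `ν` ordinary triple points as its only singularities. -/
def OnlyTriplePoints (d ν : ℕ) (f : MvPolynomial (Fin 4) ℂ) : Prop :=
  (SingSet f).Finite ∧ (SingSet f).ncard = ν ∧
  ∀ P ∈ SingSet f, OrdinaryTriplePointAt d f P.rep

/-- The restriction of `f` to the plane spanned by `a`, `b`, `c`: the ternary form
`(u, v, w) ↦ f (u • a + v • b + w • c)`. -/
def restrictPlane (a b c : Fin 4 → ℂ) (f : MvPolynomial (Fin 4) ℂ) :
    MvPolynomial (Fin 3) ℂ :=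
  MvPolynomial.aeval
    (fun i => MvPolynomial.C (a i) * MvPolynomial.X 0 +
      MvPolynomial.C (b i) * MvPolynomial.X 1 +
      MvPolynomial.C (c i) * MvPolynomial.X 2) f

/-- Chain rule: a derivation applied to a polynomial expression. -/
theorem derivation_aeval {n : ℕ} {A : Type*} [CommRing A] [Algebra ℂ A] (D : Derivation ℂ A A)
    (g : Fin n → A) (f : MvPolynomial (Fin n) ℂ) :
    D (aeval g f) = ∑ i, aeval g (pderiv i f) * D (g i) := by
  induction f using MvPolynomial.induction_on with
  | C r => simp
  | add p q hp hq => simp [hp, hq, add_mul, Finset.sum_add_distrib]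
  | mul_X p j hp =>
    simp only [map_mul, aeval_X, Derivation.leibniz, smul_eq_mul, hp, pderiv_X, map_add, add_mul,
      Finset.sum_add_distrib]
    congr 1
    · rw [Finset.sum_eq_single j]
      · simp
      · intro i _ hij
        simp [hij.symm]
      · simp
    · rw [Finset.mul_sum]
      exact Finset.sum_congr rfl fun i _ => by ring

theorem multAtLeast_zero {n : ℕ} (f : MvPolynomial (Fin n) ℂ) (p : Fin n → ℂ) :
    MultAtLeast f p 0 := fun _ hl => absurd hl (Nat.not_lt_zero _)

theorem multAtLeast_succ_iff {n : ℕ} {f : MvPolynomial (Fin n) ℂ} {p : Fin n → ℂ} {m : ℕ} :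
    MultAtLeast f p (m + 1) ↔ eval p f = 0 ∧ ∀ i, MultAtLeast (pderiv i f) p m := by
  constructor
  · intro h
    exact ⟨h [] (by simp), fun i l hl => h (i :: l) (by simpa using hl)⟩
  · rintro ⟨h0, h1⟩ l hl
    cases l with
    | nil => exact h0
    | cons i l => exact h1 i l (by simpa using hl)

namespace MultAtLeast

variable {n : ℕ} {f g : MvPolynomial (Fin n) ℂ} {p : Fin n → ℂ} {m : ℕ}

theorem mono {k : ℕ} (h : MultAtLeast f p m) (hk : k ≤ m) : MultAtLeast f p k :=
  fun l hl => h l (hl.trans_le hk)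

theorem eval_eq_zero (h : MultAtLeast f p (m + 1)) : eval p f = 0 :=
  (multAtLeast_succ_iff.1 h).1

theorem pderiv (h : MultAtLeast f p (m + 1)) (i : Fin n) :
    MultAtLeast (MvPolynomial.pderiv i f) p m :=
  (multAtLeast_succ_iff.1 h).2 i

theorem zero_left (p : Fin n → ℂ) (m : ℕ) : MultAtLeast 0 p m := by
  induction m with
  | zero => exact multAtLeast_zero _ _
  | succ m ih => exact multAtLeast_succ_iff.2 ⟨by simp, fun i => by simpa using ih⟩

theorem add (hf : MultAtLeast f p m) (hg : MultAtLeast g p m) : MultAtLeast (f + g) p m := by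
  induction m generalizing f g with
  | zero => exact multAtLeast_zero _ _
  | succ m ih =>
    refine multAtLeast_succ_iff.2 ⟨by simp [hf.eval_eq_zero, hg.eval_eq_zero], fun i => ?_⟩
    rw [map_add]
    exact ih (hf.pderiv i) (hg.pderiv i)

theorem mul_C (hf : MultAtLeast f p m) (r : ℂ) : MultAtLeast (f * C r) p m := by
  induction m generalizing f with
  | zero => exact multAtLeast_zero _ _
  | succ m ih =>
    refine multAtLeast_succ_iff.2 ⟨by simp [hf.eval_eq_zero], fun i => ?_⟩
    have : MvPolynomial.pderiv i (f * C r) = MvPolynomial.pderiv i f * C r := by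
      simp [mul_comm]
    rw [this]
    exact ih (hf.pderiv i)

theorem sum {ι : Type*} (s : Finset ι) (F : ι → MvPolynomial (Fin n) ℂ)
    (h : ∀ i ∈ s, MultAtLeast (F i) p m) : MultAtLeast (∑ i ∈ s, F i) p m :=
  Finset.sum_induction F (fun f => MultAtLeast f p m) (fun _ _ => add) (zero_left p m) h

end MultAtLeast

theorem MvPolynomial.IsHomogeneous.eval_smul {n d : ℕ} {f : MvPolynomial (Fin n) ℂ}
    (hf : f.IsHomogeneous d) (r : ℂ) (p : Fin n → ℂ) :
    eval (r • p) f = r ^ d * eval p f := by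
  rw [eval_eq, eval_eq, Finset.mul_sum]
  refine Finset.sum_congr rfl fun s hs => ?_
  have hd := hf.degree_eq_sum_deg_support hs
  simp only [Pi.smul_apply, smul_eq_mul, mul_pow, Finset.prod_mul_distrib,
    Finset.prod_pow_eq_pow_sum, hd]
  ring

theorem MultAtLeast.smul {n d m : ℕ} {f : MvPolynomial (Fin n) ℂ} {p : Fin n → ℂ}
    (hf : f.IsHomogeneous d) (h : MultAtLeast f p m) (r : ℂ) : MultAtLeast f (r • p) m := by
  induction m generalizing f d with
  | zero => exact multAtLeast_zero _ _
  | succ m ih =>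
    refine multAtLeast_succ_iff.2 ⟨by rw [hf.eval_smul, h.eval_eq_zero, mul_zero], fun i => ?_⟩
    exact ih hf.pderiv (h.pderiv i)

/-- Multiplicities do not drop under restriction to a linear subspace. -/
theorem MultAtLeast.linearSubst {k n m : ℕ} {f : MvPolynomial (Fin n) ℂ}
    (g : Fin n → MvPolynomial (Fin k) ℂ) (L : Fin k → Fin n → ℂ)
    (hg : ∀ i j, MvPolynomial.pderiv j (g i) = C (L j i)) {p : Fin k → ℂ}
    (h : MultAtLeast f (fun i => eval p (g i)) m) : MultAtLeast (aeval g f) p m := by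
  induction m generalizing f with
  | zero => exact multAtLeast_zero _ _
  | succ m ih =>
    refine multAtLeast_succ_iff.2 ⟨?_, fun j => ?_⟩
    · have := h.eval_eq_zero
      rw [← coe_aeval_eq_eval, RingHom.coe_coe] at this ⊢
      rw [comp_aeval_apply]
      exact this
    · rw [derivation_aeval]
      refine MultAtLeast.sum _ _ fun i _ => ?_
      rw [hg]
      exact (ih (h.pderiv i)).mul_C _

theorem eval_aeval_polynomial {n : ℕ} (γ : Fin n → Polynomial ℂ) (f : MvPolynomial (Fin n) ℂ)
    (t : ℂ) : (aeval γ f).eval t = eval (fun i => (γ i).eval t) f := by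
  rw [← coe_aeval_eq_eval, RingHom.coe_coe, ← Polynomial.coe_aeval_eq_eval, ← comp_aeval_apply]

theorem Polynomial.X_sub_C_pow_succ_dvd {P : Polynomial ℂ} {t : ℂ} {m : ℕ} (h0 : P.eval t = 0)
    (h1 : (Polynomial.X - Polynomial.C t) ^ m ∣ Polynomial.derivative P) :
    (Polynomial.X - Polynomial.C t) ^ (m + 1) ∣ P := by
  rcases eq_or_ne P 0 with rfl | hP
  · exact dvd_zero _
  rw [← Polynomial.le_rootMultiplicity_iff hP]
  have hpos : 0 < P.rootMultiplicity t := (Polynomial.rootMultiplicity_pos hP).2 h0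
  have hd : Polynomial.derivative P ≠ 0 := by
    intro hd
    have hc := Polynomial.derivative_eq_zero.1 hd
    rw [Polynomial.eq_C_of_natDegree_eq_zero hc] at h0 hP
    simp only [Polynomial.eval_C] at h0
    simp [h0] at hP
  have := (Polynomial.le_rootMultiplicity_iff hd).2 h1
  rw [Polynomial.derivative_rootMultiplicity_of_root h0] at this
  omega

/-- A parametrized curve meets a hypersurface at least with the multiplicity of the point. -/
theorem MultAtLeast.dvd_aeval {n m : ℕ} {f : MvPolynomial (Fin n) ℂ} {γ : Fin n → Polynomial ℂ}
    {t : ℂ} (h : MultAtLeast f (fun i => (γ i).eval t) m) :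
    (Polynomial.X - Polynomial.C t) ^ m ∣ aeval γ f := by
  induction m generalizing f with
  | zero => simp
  | succ m ih =>
    refine Polynomial.X_sub_C_pow_succ_dvd ?_ ?_
    · rw [eval_aeval_polynomial]
      exact h.eval_eq_zero
    · have := derivation_aeval Polynomial.derivative' γ f
      simp only [Polynomial.derivative'_apply] at this
      rw [this]
      exact Finset.dvd_sum fun i _ => (ih (h.pderiv i)).mul_right _

/-- Weak Bézout: a hypersurface of degree `d` meeting a parametrized curve of degree `e` with
total multiplicity more than `d * e` contains it. -/
theorem aeval_eq_zero_of_multAtLeast {n m d e N : ℕ} {f : MvPolynomial (Fin n) ℂ}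
    (hf : f.IsHomogeneous d) {γ : Fin n → Polynomial ℂ} (hγ : ∀ i, (γ i).natDegree ≤ e)
    {t : Fin N → ℂ} (ht : Function.Injective t)
    (h : ∀ j, MultAtLeast f (fun i => (γ i).eval (t j)) m) (hlt : d * e < N * m) :
    aeval γ f = 0 := by
  by_contra hne
  have hdvd : ∏ j : Fin N, (Polynomial.X - Polynomial.C (t j)) ^ m ∣ aeval γ f := by
    refine Finset.prod_dvd_of_coprime (fun i _ j _ hij => ?_) fun j _ => (h j).dvd_aeval
    exact IsCoprime.pow (Polynomial.pairwise_coprime_X_sub_C ht hij)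
  have hdeg := Polynomial.natDegree_le_of_dvd hdvd hne
  have h2 := aeval_natDegree_le f hf.totalDegree_le γ hγ
  rw [Polynomial.natDegree_prod_of_monic _ _ fun j _ => (Polynomial.monic_X_sub_C _).pow m] at hdeg
  simp at hdeg
  omega

/-- A sextic with enough triple points on a parametrized curve is singular along that curve. -/
theorem multAtLeast_two_of_curve {n e N : ℕ} {f : MvPolynomial (Fin n) ℂ}
    (hf : f.IsHomogeneous 6) {γ : Fin n → Polynomial ℂ} (hγ : ∀ i, (γ i).natDegree ≤ e)
    {t : Fin N → ℂ} (ht : Function.Injective t)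
    (h : ∀ j, MultAtLeast f (fun i => (γ i).eval (t j)) 3) (hlt : 5 * e < N * 2) (s : ℂ) :
    MultAtLeast f (fun i => (γ i).eval s) 2 := by
  refine multAtLeast_succ_iff.2 ⟨?_, fun i => multAtLeast_succ_iff.2
    ⟨?_, fun _ => multAtLeast_zero _ _⟩⟩
  · rw [← eval_aeval_polynomial, aeval_eq_zero_of_multAtLeast hf hγ ht h (by omega)]
    simp
  · rw [← eval_aeval_polynomial,
      aeval_eq_zero_of_multAtLeast (hf.pderiv (i := i)) hγ ht (fun j => (h j).pderiv i) (by omega)]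
    simp

/-- Pairwise non-proportional singular points force the singular locus to be infinite. -/
theorem not_singular_family {f : MvPolynomial (Fin 4) ℂ} (hf : f.IsHomogeneous 6)
    (hfin : (SingSet f).Finite) (p : ℂ → Fin 4 → ℂ) (hp : ∀ t, p t ≠ 0)
    (hinj : ∀ (s t r : ℂ), p s = r • p t → s = t) (hs : ∀ t, SingularAt f (p t)) : False := by
  have hi : Function.Injective fun t => Projectivization.mk ℂ (p t) (hp t) := by
    intro s t hst
    obtain ⟨r, hr⟩ := (Projectivization.mk_eq_mk_iff' ℂ _ _ (hp s) (hp t)).1 hst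
    exact hinj s t r hr.symm
  refine Set.infinite_range_of_injective hi (hfin.subset ?_)
  rintro _ ⟨t, rfl⟩
  obtain ⟨r, hr⟩ := Projectivization.exists_smul_eq_mk_rep ℂ (p t) (hp t)
  show SingularAt f _
  rw [← hr]
  exact MultAtLeast.smul hf (hs t) (r : ℂ)
/-- If the product of a form smooth at `p` and `G` has a double point at `p`, then `G`
vanishes at `p`. -/
theorem eval_eq_zero_of_mul {n : ℕ} {q G : MvPolynomial (Fin n) ℂ} {p : Fin n → ℂ} {i : Fin n}
    (hi : eval p (pderiv i q) ≠ 0) (h0 : eval p q = 0) (h : MultAtLeast (q * G) p 2) :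
    eval p G = 0 := by
  have := (h.pderiv i).eval_eq_zero
  simpa [h0, hi] using this

/-- If the product of a form smooth at `p` and `G` has a triple point at `p`, then `G` has a
double point at `p`. -/
theorem multAtLeast_two_of_mul {n : ℕ} {q G : MvPolynomial (Fin n) ℂ} {p : Fin n → ℂ} {i : Fin n}
    (hi : eval p (pderiv i q) ≠ 0) (h0 : eval p q = 0) (h : MultAtLeast (q * G) p 3) :
    MultAtLeast G p 2 := by
  have hG : eval p G = 0 := eval_eq_zero_of_mul hi h0 (h.mono (by norm_num))
  have key : ∀ j k, eval p (pderiv j q) * eval p (pderiv k G) +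
      eval p (pderiv k q) * eval p (pderiv j G) = 0 := by
    intro j k
    have := ((h.pderiv j).pderiv k).eval_eq_zero
    simp [h0, hG] at this
    linear_combination this
  have hii : eval p (pderiv i G) = 0 := by
    have h2 := key i i
    rw [← two_mul] at h2
    simpa [hi] using h2
  refine multAtLeast_succ_iff.2 ⟨hG, fun j => multAtLeast_succ_iff.2
    ⟨?_, fun _ => multAtLeast_zero _ _⟩⟩
  simpa [hi, hii] using key i j

/-- The standard conic `x₁² - x₀ x₂`. -/
def stdConic : MvPolynomial (Fin 3) ℂ := X 1 ^ 2 - X 0 * X 2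

/-- The parametrization `(1, t, t²)` of the standard conic. -/
def stdCurve : Fin 3 → Polynomial ℂ := ![1, Polynomial.X, Polynomial.X ^ 2]

theorem stdCurve_eval (t : ℂ) : (fun i => (stdCurve i).eval t) = ![1, t, t ^ 2] := by
  funext i
  fin_cases i <;> simp [stdCurve]

theorem stdCurve_natDegree_le (i : Fin 3) : (stdCurve i).natDegree ≤ 2 := by
  fin_cases i <;> simp [stdCurve]

/-- The normal form, modulo the standard conic, of the monomials of degree `d` and weight `w`. -/
def conicNormalForm (d w : ℕ) : MvPolynomial (Fin 3) ℂ :=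
  X 0 ^ (d - (w + 1) / 2) * X 1 ^ (w % 2) * X 2 ^ (w / 2)

theorem monomial_sub_conicNormalForm (d b : ℕ) : ∀ a c : ℕ, a + b + c = d + 2 →
    ∃ G : MvPolynomial (Fin 3) ℂ, G.IsHomogeneous d ∧
      X 0 ^ a * X 1 ^ b * X 2 ^ c - conicNormalForm (d + 2) (b + 2 * c) = stdConic * G := by
  induction b using Nat.strong_induction_on with
  | _ b ih =>
    intro a c habc
    rcases lt_or_ge b 2 with hb | hb
    · refine ⟨0, isHomogeneous_zero _ _ _, ?_⟩
      have h1 : d + 2 - (b + 2 * c + 1) / 2 = a := by omega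
      have h2 : (b + 2 * c) % 2 = b := by omega
      have h3 : (b + 2 * c) / 2 = c := by omega
      rw [conicNormalForm, h1, h2, h3, sub_self, mul_zero]
    · obtain ⟨k, rfl⟩ := Nat.exists_eq_add_of_le' hb
      obtain ⟨G, hG, hGe⟩ := ih k (by omega) (a + 1) (c + 1) (by omega)
      refine ⟨G + X 0 ^ a * X 1 ^ k * X 2 ^ c, hG.add ?_, ?_⟩
      · have : a + k + c = d := by omega
        rw [← this]
        exact ((isHomogeneous_X_pow _ _).mul (isHomogeneous_X_pow _ _)).mul
          (isHomogeneous_X_pow _ _)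
      · rw [mul_add, ← hGe, show k + 2 * (c + 1) = k + 2 + 2 * c by ring, stdConic]
        ring

/-- A form vanishing on the standard conic is divisible by its equation. -/
theorem exists_eq_stdConic_mul {d : ℕ} {F : MvPolynomial (Fin 3) ℂ} (hF : F.IsHomogeneous (d + 2))
    (h : aeval stdCurve F = 0) : ∃ G, G.IsHomogeneous d ∧ F = stdConic * G := by
  let Φ : Polynomial ℂ →ₗ[ℂ] MvPolynomial (Fin 3) ℂ :=
    (Polynomial.basisMonomials ℂ).constr ℂ (conicNormalForm (d + 2))
  let T : MvPolynomial (Fin 3) ℂ →ₗ[ℂ] MvPolynomial (Fin 3) ℂ :=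
    LinearMap.id - Φ ∘ₗ (aeval stdCurve).toLinearMap
  let S : Submodule ℂ (MvPolynomial (Fin 3) ℂ) :=
    (homogeneousSubmodule (Fin 3) ℂ d).map (LinearMap.mulLeft ℂ stdConic)
  have hT : T F ∈ S := by
    rw [F.as_sum, map_sum]
    refine Submodule.sum_mem _ fun s hs => ?_
    have hd := hF.degree_eq_sum_deg_support hs
    rw [← Finsupp.degree_apply, Finsupp.degree_eq_sum, Fin.sum_univ_three] at hd
    have hmon : monomial s (coeff s F) =
        coeff s F • (X 0 ^ s 0 * X 1 ^ s 1 * X 2 ^ s 2 : MvPolynomial (Fin 3) ℂ) := by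
      rw [monomial_eq, Finsupp.prod_fintype _ _ (fun _ => pow_zero _), Fin.prod_univ_three,
        smul_eq_C_mul]
    rw [hmon, map_smul]
    refine Submodule.smul_mem _ _ ?_
    obtain ⟨G, hG, hGe⟩ := monomial_sub_conicNormalForm d (s 1) (s 0) (s 2) hd.symm
    refine ⟨G, hG, ?_⟩
    have hcurve : aeval stdCurve (X 0 ^ s 0 * X 1 ^ s 1 * X 2 ^ s 2 : MvPolynomial (Fin 3) ℂ) =
        Polynomial.basisMonomials ℂ (s 1 + 2 * s 2) := by
      simp [stdCurve, Polynomial.coe_basisMonomials, ← Polynomial.X_pow_eq_monomial, pow_add,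
        pow_mul]
    simp only [LinearMap.mulLeft_apply, ← hGe, T, LinearMap.sub_apply, LinearMap.id_apply,
      LinearMap.comp_apply, AlgHom.toLinearMap_apply, hcurve, Φ, Module.Basis.constr_basis]
  obtain ⟨G, hG, hGe⟩ := hT
  refine ⟨G, hG, ?_⟩
  simpa [T, h] using hGe.symm

/-- A ternary sextic with five triple points on the standard conic is a multiple of the cube of
the equation of the conic. -/
theorem eq_C_mul_stdConic_pow_three {F : MvPolynomial (Fin 3) ℂ} (hF : F.IsHomogeneous 6)
    {t : Fin 5 → ℂ} (ht : Function.Injective t)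
    (h : ∀ j, MultAtLeast F ![1, t j, t j ^ 2] 3) : ∃ r, F = C r * stdConic ^ 3 := by
  have hq0 : ∀ s : ℂ, eval ![1, s, s ^ 2] stdConic = 0 := fun s => by simp [stdConic]
  have hq1 : ∀ s : ℂ, eval ![1, s, s ^ 2] (pderiv 2 stdConic) ≠ 0 := fun s => by
    simp [stdConic, pderiv_X]
  obtain ⟨G, hG, rfl⟩ := exists_eq_stdConic_mul (d := 4) hF <|
    aeval_eq_zero_of_multAtLeast hF stdCurve_natDegree_le ht
      (fun j => by rw [stdCurve_eval]; exact h j) (by norm_num)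
  have h2 : ∀ j, MultAtLeast G ![1, t j, t j ^ 2] 2 := fun j =>
    multAtLeast_two_of_mul (hq1 _) (hq0 _) (h j)
  obtain ⟨K, hK, rfl⟩ := exists_eq_stdConic_mul (d := 2) hG <|
    aeval_eq_zero_of_multAtLeast hG stdCurve_natDegree_le ht
      (fun j => by rw [stdCurve_eval]; exact h2 j) (by norm_num)
  have h1 : ∀ j, MultAtLeast K ![1, t j, t j ^ 2] 1 := fun j => multAtLeast_succ_iff.2
    ⟨eval_eq_zero_of_mul (hq1 _) (hq0 _) (h2 j), fun _ => multAtLeast_zero _ _⟩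
  obtain ⟨R, hR, rfl⟩ := exists_eq_stdConic_mul (d := 0) hK <|
    aeval_eq_zero_of_multAtLeast hK stdCurve_natDegree_le ht
      (fun j => by rw [stdCurve_eval]; exact h1 j) (by norm_num)
  refine ⟨coeff 0 R, ?_⟩
  rw [← totalDegree_eq_zero_iff_eq_C.1 (Nat.le_zero.1 hR.totalDegree_le)]
  ring

/-- A parametrized smooth conic through the coordinate points and two further general points,
whose point at infinity avoids a given point. -/
theorem exists_conic_normalized (x y z : Fin 3 → ℂ) (hx : ∀ i, x i ≠ 0) (hy : ∀ i, y i ≠ 0)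
    (hxy : ∀ i j, i ≠ j → x i * y j ≠ x j * y i) (hz : z ≠ 0) :
    ∃ (K : Matrix (Fin 3) (Fin 3) ℂ) (t l : Fin 5 → ℂ), K.det ≠ 0 ∧ (∀ j, l j ≠ 0) ∧
      (∀ j, (![Pi.single 0 1, Pi.single 1 1, Pi.single 2 1, x, y] : Fin 5 → Fin 3 → ℂ) j =
        l j • K.mulVec ![1, t j, t j ^ 2]) ∧
      ∀ r : ℂ, z ≠ r • K.mulVec ![0, 0, 1] := by
  obtain ⟨m, hm⟩ := Infinite.exists_notMem_finset
    ({0, y 0 / x 0, y 1 / x 1, y 2 / x 2,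
      (z 0 / x 0 - z 1 / x 1) / (z 0 / y 0 - z 1 / y 1)} : Finset ℂ)
  simp only [Finset.mem_insert, Finset.mem_singleton, not_or] at hm
  obtain ⟨hm0, hmx0, hmx1, hmx2, hmz⟩ := hm
  have hx0 := hx 0
  have hx1 := hx 1
  have hx2 := hx 2
  have hy0 := hy 0
  have hy1 := hy 1
  have hy2 := hy 2
  obtain ⟨u, hu⟩ : ∃ u : Fin 3 → ℂ, ∀ i, u i = 1 / x i := ⟨_, fun _ => rfl⟩
  obtain ⟨v, hv⟩ : ∃ v : Fin 3 → ℂ, ∀ i, v i = m / y i - 1 / x i := ⟨_, fun _ => rfl⟩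
  have hv' : ∀ i, m ≠ y i / x i → v i ≠ 0 := by
    intro i h h0
    apply h
    have hxi := hx i
    have hyi := hy i
    rw [hv] at h0
    field_simp at h0 ⊢
    linear_combination h0
  have hv0 := hv' 0 hmx0
  have hv1 := hv' 1 hmx1
  have hv2 := hv' 2 hmx2
  have huv : ∀ i j, i ≠ j → u i * v j - u j * v i ≠ 0 := by
    intro i j hij h0
    apply hxy i j hij
    have hxi := hx i
    have hyi := hy i
    have hxj := hx j
    have hyj := hy j
    rw [hu, hu, hv, hv] at h0
    field_simp at h0
    have h1 : m * (x j * y i - x i * y j) = 0 := by linear_combination h0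
    have h2 := (mul_eq_zero.1 h1).resolve_left hm0
    linear_combination -h2
  have h01 := huv 0 1 (by decide)
  have h02 := huv 0 2 (by decide)
  have h12 := huv 1 2 (by decide)
  obtain ⟨K, hKdef⟩ : ∃ K : Matrix (Fin 3) (Fin 3) ℂ,
      K = !![u 1 * u 2, u 1 * v 2 + u 2 * v 1, v 1 * v 2;
        u 0 * u 2, u 0 * v 2 + u 2 * v 0, v 0 * v 2;
        u 0 * u 1, u 0 * v 1 + u 1 * v 0, v 0 * v 1] := ⟨_, rfl⟩
  have hK : ∀ s : ℂ, K.mulVec ![1, s, s ^ 2] = ![(u 1 + s * v 1) * (u 2 + s * v 2),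
      (u 0 + s * v 0) * (u 2 + s * v 2), (u 0 + s * v 0) * (u 1 + s * v 1)] := by
    intro s
    funext i
    fin_cases i <;> simp [hKdef] <;> ring
  obtain ⟨τ, hτ⟩ : ∃ τ : Fin 3 → ℂ, ∀ i, τ i = -u i / v i := ⟨_, fun _ => rfl⟩
  have hvi : ∀ i, v i ≠ 0 := by
    intro i
    fin_cases i
    exacts [hv0, hv1, hv2]
  have hroot : ∀ i, u i + τ i * v i = 0 := by
    intro i
    rw [hτ, div_mul_cancel₀ _ (hvi i), add_neg_cancel]
  have hnz : ∀ i j, i ≠ j → u j + τ i * v j ≠ 0 := by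
    intro i j hij h0
    apply huv i j hij
    linear_combination v j * hroot i - v i * h0
  have n01 := hnz 0 1 (by decide)
  have n02 := hnz 0 2 (by decide)
  have n10 := hnz 1 0 (by decide)
  have n12 := hnz 1 2 (by decide)
  have n20 := hnz 2 0 (by decide)
  have n21 := hnz 2 1 (by decide)
  refine ⟨K, ![τ 0, τ 1, τ 2, 0, 1],
    ![((u 1 + τ 0 * v 1) * (u 2 + τ 0 * v 2))⁻¹, ((u 0 + τ 1 * v 0) * (u 2 + τ 1 * v 2))⁻¹,
      ((u 0 + τ 2 * v 0) * (u 1 + τ 2 * v 1))⁻¹, x 0 * x 1 * x 2, y 0 * y 1 * y 2 / m ^ 2],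
    ?_, ?_, ?_, ?_⟩
  · have : (u 0 * v 1 - u 1 * v 0) * (u 0 * v 2 - u 2 * v 0) * (u 1 * v 2 - u 2 * v 1) ≠ 0 :=
      mul_ne_zero (mul_ne_zero h01 h02) h12
    intro h0
    apply this
    rw [hKdef, Matrix.det_fin_three] at h0
    simp at h0
    linear_combination -1 * h0
  · intro j
    fin_cases j
    · exact inv_ne_zero (mul_ne_zero n01 n02)
    · exact inv_ne_zero (mul_ne_zero n10 n12)
    · exact inv_ne_zero (mul_ne_zero n20 n21)
    · exact mul_ne_zero (mul_ne_zero hx0 hx1) hx2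
    · exact div_ne_zero (mul_ne_zero (mul_ne_zero hy0 hy1) hy2) (pow_ne_zero 2 hm0)
  · intro j
    rw [hK]
    fin_cases j
    · funext i
      fin_cases i <;> simp [-mul_inv_rev, hroot, n01, n02]
    · funext i
      fin_cases i <;> simp [-mul_inv_rev, hroot, n10, n12]
    · funext i
      fin_cases i <;> simp [-mul_inv_rev, hroot, n20, n21]
    · funext i
      fin_cases i <;> simp [hu] <;> field_simp
    · funext i
      fin_cases i <;> simp [hu, hv] <;> field_simp
  · intro r hr
    have e0 : z 0 = r * (v 1 * v 2) := by
      rw [hr, hKdef]; simp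
    have e1 : z 1 = r * (v 0 * v 2) := by
      rw [hr, hKdef]; simp
    have hr0 : r ≠ 0 := by
      rintro rfl
      exact hz (by rw [hr, zero_smul])
    have hz0 : z 0 ≠ 0 := by
      rw [e0]
      exact mul_ne_zero hr0 (mul_ne_zero hv1 hv2)
    have hlin : m * (z 0 / y 0 - z 1 / y 1) = z 0 / x 0 - z 1 / x 1 := by
      have : z 0 * v 0 = z 1 * v 1 := by rw [e0, e1]; ring
      rw [hv, hv] at this
      linear_combination this
    by_cases hden : z 0 / y 0 - z 1 / y 1 = 0
    · rw [hden, mul_zero] at hlin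
      apply hxy 0 1 (by decide)
      field_simp at hden hlin
      apply mul_left_cancel₀ hz0
      linear_combination x 0 * hden + y 0 * hlin
    · exact hmz (eq_div_of_mul_eq hden hlin)

/-- Five plane points, no three of them collinear, lie on a parametrized smooth conic whose point
at infinity avoids a given point. -/
theorem exists_conic_through_five (w : Fin 5 → Fin 3 → ℂ)
    (hw : ∀ i j k, i ≠ j → i ≠ k → j ≠ k → ∀ α β γ : ℂ,
      α • w i + β • w j + γ • w k = 0 → α = 0 ∧ β = 0 ∧ γ = 0)
    (z : Fin 3 → ℂ) (hz : z ≠ 0) :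
    ∃ (T : Matrix (Fin 3) (Fin 3) ℂ) (t l : Fin 5 → ℂ), T.det ≠ 0 ∧ Function.Injective t ∧
      (∀ j, l j ≠ 0) ∧ (∀ j, w j = l j • T.mulVec ![1, t j, t j ^ 2]) ∧
      ∀ r : ℂ, z ≠ r • T.mulVec ![0, 0, 1] := by
  let W : Matrix (Fin 3) (Fin 3) ℂ := Matrix.of fun i j => ![w 0, w 1, w 2] j i
  have hWv : ∀ v : Fin 3 → ℂ, W.mulVec v = v 0 • w 0 + v 1 • w 1 + v 2 • w 2 := by
    intro v
    funext i
    simp [W, Matrix.mulVec, dotProduct, Fin.sum_univ_three]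
    ring
  have hW : W.det ≠ 0 := by
    intro h0
    obtain ⟨v, hv, hv0⟩ := Matrix.exists_mulVec_eq_zero_iff.2 h0
    rw [hWv] at hv0
    obtain ⟨h0, h1, h2⟩ := hw 0 1 2 (by decide) (by decide) (by decide) _ _ _ hv0
    apply hv
    funext i
    fin_cases i <;> simp [h0, h1, h2]
  have hWu : IsUnit W.det := isUnit_iff_ne_zero.2 hW
  have hinv : ∀ v, W.mulVec (W⁻¹.mulVec v) = v := fun v => by
    rw [Matrix.mulVec_mulVec, Matrix.mul_nonsing_inv _ hWu, Matrix.one_mulVec]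
  obtain ⟨x, hx⟩ : ∃ x, w 3 = W.mulVec x := ⟨_, (hinv _).symm⟩
  obtain ⟨y, hy⟩ : ∃ y, w 4 = W.mulVec y := ⟨_, (hinv _).symm⟩
  obtain ⟨z', hz'⟩ : ∃ z', z = W.mulVec z' := ⟨_, (hinv _).symm⟩
  have hx' := hx
  have hy' := hy
  rw [hWv] at hx' hy'
  have hx0 : ∀ i, x i ≠ 0 := by
    intro i h
    fin_cases i <;> simp only [Fin.zero_eta, Fin.mk_one, Fin.reduceFinMk] at h <;>
      rw [h, zero_smul] at hx'
    · refine one_ne_zero (hw 1 2 3 (by decide) (by decide) (by decide) (-x 1) (-x 2) 1 ?_).2.2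
      rw [hx']; module
    · refine one_ne_zero (hw 0 2 3 (by decide) (by decide) (by decide) (-x 0) (-x 2) 1 ?_).2.2
      rw [hx']; module
    · refine one_ne_zero (hw 0 1 3 (by decide) (by decide) (by decide) (-x 0) (-x 1) 1 ?_).2.2
      rw [hx']; module
  have hy0 : ∀ i, y i ≠ 0 := by
    intro i h
    fin_cases i <;> simp only [Fin.zero_eta, Fin.mk_one, Fin.reduceFinMk] at h <;>
      rw [h, zero_smul] at hy'
    · refine one_ne_zero (hw 1 2 4 (by decide) (by decide) (by decide) (-y 1) (-y 2) 1 ?_).2.2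
      rw [hy']; module
    · refine one_ne_zero (hw 0 2 4 (by decide) (by decide) (by decide) (-y 0) (-y 2) 1 ?_).2.2
      rw [hy']; module
    · refine one_ne_zero (hw 0 1 4 (by decide) (by decide) (by decide) (-y 0) (-y 1) 1 ?_).2.2
      rw [hy']; module
  have h01 : x 0 * y 1 ≠ x 1 * y 0 := by
    intro h
    refine hx0 0 (neg_eq_zero.1 (hw 2 3 4 (by decide) (by decide) (by decide)
      (x 0 * y 2 - y 0 * x 2) (y 0) (-x 0) ?_).2.2)
    rw [hx', hy']
    linear_combination (norm := module) -h • w 1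
  have h02 : x 0 * y 2 ≠ x 2 * y 0 := by
    intro h
    refine hx0 0 (neg_eq_zero.1 (hw 1 3 4 (by decide) (by decide) (by decide)
      (x 0 * y 1 - y 0 * x 1) (y 0) (-x 0) ?_).2.2)
    rw [hx', hy']
    linear_combination (norm := module) -h • w 2
  have h12 : x 1 * y 2 ≠ x 2 * y 1 := by
    intro h
    refine hx0 1 (neg_eq_zero.1 (hw 0 3 4 (by decide) (by decide) (by decide)
      (x 1 * y 0 - y 1 * x 0) (y 1) (-x 1) ?_).2.2)
    rw [hx', hy']
    linear_combination (norm := module) -h • w 2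
  have hxy : ∀ i j, i ≠ j → x i * y j ≠ x j * y i := by
    intro i j hij
    fin_cases i <;> fin_cases j <;> first | exact absurd rfl hij | skip
    exacts [h01, h02, h01.symm, h12, h02.symm, h12.symm]
  have hz0 : z' ≠ 0 := by
    rintro rfl
    exact hz (by rw [hz', Matrix.mulVec_zero])
  obtain ⟨K, t, l, hK, hl, hKw, hKz⟩ := exists_conic_normalized x y z' hx0 hy0 hxy hz0
  have hT : ∀ j, w j = l j • (W * K).mulVec ![1, t j, t j ^ 2] := by
    intro j
    rw [← Matrix.mulVec_mulVec, ← Matrix.mulVec_smul, ← hKw]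
    fin_cases j
    · simp [hWv]
    · simp [hWv]
    · simp [hWv]
    · exact hx
    · exact hy
  refine ⟨W * K, t, l, by rw [Matrix.det_mul]; exact mul_ne_zero hW hK, ?_, hl, hT, ?_⟩
  · intro i j hij
    by_contra hne
    obtain ⟨k, hik, hjk⟩ : ∃ k : Fin 5, i ≠ k ∧ j ≠ k := by
      clear hij
      revert i j
      decide
    refine hl j (hw i j k hne hik hjk (l j) (-l i) 0 ?_).1
    rw [hT i, hT j, hij]
    module
  · intro r hr
    rw [← Matrix.mulVec_mulVec, ← Matrix.mulVec_smul, hz'] at hr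
    apply hKz r
    have := congrArg W⁻¹.mulVec hr
    simpa [Matrix.mulVec_mulVec, Matrix.nonsing_inv_mul _ hWu] using this

/-- A form of positive degree that does not vanish at `b` has a zero on every affine line with
direction `b`. -/
theorem MvPolynomial.IsHomogeneous.exists_zero_on_line {n d : ℕ} (hd : d ≠ 0)
    {g : MvPolynomial (Fin n) ℂ} (hg : g.IsHomogeneous d) (a b : Fin n → ℂ)
    (hb : MvPolynomial.eval b g ≠ 0) : ∃ r : ℂ, MvPolynomial.eval (a + r • b) g = 0 := by
  have hline : ∀ (u v : Fin n → ℂ) (s : ℂ), Polynomial.eval s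
      (MvPolynomial.aeval (fun i => Polynomial.C (u i) + Polynomial.X * Polynomial.C (v i)) g) =
        MvPolynomial.eval (u + s • v) g := by
    intro u v s
    have h : (fun i => (Polynomial.C (u i) + Polynomial.X * Polynomial.C (v i)).eval s) =
        u + s • v := by
      funext i
      simp
      ring
    rw [eval_aeval_polynomial, h]
  by_contra! hne
  have hdeg : (MvPolynomial.aeval
      (fun i => Polynomial.C (a i) + Polynomial.X * Polynomial.C (b i)) g).degree = 0 := by
    by_contra h
    obtain ⟨r, hr⟩ := IsAlgClosed.exists_root _ h
    exact hne r (by rw [← hline]; exact hr)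
  have hconst : ∀ s : ℂ, MvPolynomial.eval (a + s • b) g = MvPolynomial.eval a g := by
    intro s
    have h := hline a b 0
    rw [Polynomial.eq_C_of_degree_eq_zero hdeg, Polynomial.eval_C, zero_smul, add_zero] at h
    rw [← hline, Polynomial.eq_C_of_degree_eq_zero hdeg, Polynomial.eval_C, h]
  have hrev : MvPolynomial.aeval (fun i => Polynomial.C (b i) + Polynomial.X * Polynomial.C (a i)) g =
      Polynomial.C (MvPolynomial.eval a g) * Polynomial.X ^ d := by
    refine Polynomial.eq_of_infinite_eval_eq _ _
      ((Set.finite_singleton (0 : ℂ)).infinite_compl.mono fun s hs => ?_)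
    have hs0 : s ≠ 0 := hs
    have h : b + s • a = s • (a + s⁻¹ • b) := by
      rw [smul_add, smul_inv_smul₀ hs0, add_comm]
    rw [Set.mem_ofPred_eq, hline, h, hg.eval_smul, hconst]
    rw [Polynomial.eval_mul, Polynomial.eval_C, Polynomial.eval_pow, Polynomial.eval_X, mul_comm]
  apply hb
  have h := congrArg (Polynomial.eval 0) hrev
  rw [hline] at h
  simpa [hd] using h

/-- Three collinear triple points would make a sextic singular along a line. -/
theorem no_three_collinear {f : MvPolynomial (Fin 4) ℂ} (hf : f.IsHomogeneous 6)
    (hfin : (SingSet f).Finite) {p₁ p₂ p₃ : Fin 4 → ℂ}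
    (hind : ∀ r s : ℂ, r • p₁ + s • p₂ = 0 → r = 0 ∧ s = 0) {α β : ℂ} (hα : α ≠ 0) (hβ : β ≠ 0)
    (h₃ : p₃ = α • p₁ + β • p₂) (m₁ : MultAtLeast f p₁ 3) (m₂ : MultAtLeast f p₂ 3)
    (m₃ : MultAtLeast f p₃ 3) : False := by
  obtain ⟨m, hm⟩ := Infinite.exists_notMem_finset ({0, β / α} : Finset ℂ)
  simp only [Finset.mem_insert, Finset.mem_singleton, not_or] at hm
  obtain ⟨hm0, hmβ⟩ := hm
  have hδ : β - α * m ≠ 0 := by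
    intro h
    apply hmβ
    field_simp
    linear_combination -h
  let γ : Fin 4 → Polynomial ℂ := fun i =>
    Polynomial.C (p₂ i) + Polynomial.X * Polynomial.C ((p₁ + m • p₂) i)
  have hγ : ∀ s, (fun i => (γ i).eval s) = p₂ + s • (p₁ + m • p₂) := by
    intro s
    funext i
    simp [γ]
    ring
  have hdeg : ∀ i, (γ i).natDegree ≤ 1 := by
    intro i
    simp only [γ]
    compute_degree
  have hsing : ∀ s : ℂ, SingularAt f (p₂ + s • (p₁ + m • p₂)) := by
    intro s
    rw [← hγ]
    refine multAtLeast_two_of_curve (t := ![0, -1 / m, α / (β - α * m)]) hf hdeg ?_ ?_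
      (by norm_num) s
    · have e1 : -1 / m ≠ 0 := by simp [hm0]
      have e2 : α / (β - α * m) ≠ 0 := div_ne_zero hα hδ
      have e3 : -1 / m ≠ α / (β - α * m) := by
        intro h
        rw [div_eq_div_iff hm0 hδ] at h
        apply hβ
        linear_combination -h
      intro i j hij
      fin_cases i <;> fin_cases j <;> first | rfl | skip
      exacts [absurd hij.symm e1, absurd hij.symm e2, absurd hij e1, absurd hij e3,
        absurd hij e2, absurd hij.symm e3]
    · intro j
      rw [hγ]
      fin_cases j
      · simpa using m₂
      · have : p₂ + (-1 / m) • (p₁ + m • p₂) = (-1 / m) • p₁ := by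
          match_scalars <;> field_simp <;> ring
        simp only [Fin.mk_one, Matrix.cons_val_one, Matrix.cons_val_zero]
        rw [this]
        exact m₁.smul hf _
      · have : p₂ + (α / (β - α * m)) • (p₁ + m • p₂) = (1 / (β - α * m)) • p₃ := by
          rw [h₃]
          match_scalars <;> field_simp <;> ring
        simp only [Fin.reduceFinMk, Matrix.cons_val]
        rw [this]
        exact m₃.smul hf _
  refine not_singular_family hf hfin _ (fun s hs => ?_) (fun s t r h => ?_) hsing
  · obtain ⟨h1, h2⟩ := hind s (1 + s * m) (by rw [← hs]; module)
    rw [h1] at h2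
    simp at h2
  · obtain ⟨h1, h2⟩ := hind (s - r * t) (1 + s * m - r * (1 + t * m))
      (by linear_combination (norm := module) h)
    have hr : r = 1 := by linear_combination -h2 + m * h1
    rw [hr] at h1
    linear_combination h1

/-- Six triple points on a smooth plane conic would make a sextic singular along that conic. -/
theorem no_six_on_conic {f : MvPolynomial (Fin 4) ℂ} (hf : f.IsHomogeneous 6)
    (hfin : (SingSet f).Finite) {L : (Fin 3 → ℂ) →ₗ[ℂ] (Fin 4 → ℂ)} (hL : Function.Injective L)
    {t : Fin 6 → ℂ} (ht : Function.Injective t)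
    (h : ∀ j, MultAtLeast f (L ![1, t j, t j ^ 2]) 3) : False := by
  let γ : Fin 4 → Polynomial ℂ := fun i => ∑ j, Polynomial.C (L (Pi.single j 1) i) * stdCurve j
  have hγ : ∀ s, (fun i => (γ i).eval s) = L ![1, s, s ^ 2] := by
    intro s
    have hsingle : ∀ j : Fin 3, (fun i => if j = i then (1 : ℂ) else 0) = Pi.single j 1 := by
      intro j
      funext i
      simp [Pi.single_apply, eq_comm]
    rw [← stdCurve_eval, LinearMap.pi_apply_eq_sum_univ L]
    simp only [hsingle]
    funext i
    simp [γ, Polynomial.eval_finsetSum, mul_comm]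
  have hdeg : ∀ i, (γ i).natDegree ≤ 2 := fun i =>
    Polynomial.natDegree_sum_le_of_forall_le _ _ fun j _ =>
      (Polynomial.natDegree_C_mul_le _ _).trans (stdCurve_natDegree_le j)
  have hsing : ∀ s, SingularAt f (L ![1, s, s ^ 2]) := by
    intro s
    rw [← hγ]
    exact multAtLeast_two_of_curve hf hdeg ht (fun j => by rw [hγ]; exact h j) (by norm_num) s
  refine not_singular_family hf hfin _ (fun s hs => ?_) (fun s t r h => ?_) hsing
  · have := congrFun (hL (hs.trans (map_zero L).symm)) 0
    simp at this
  · rw [← map_smul] at h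
    have h0 := congrFun (hL h) 0
    have h1 := congrFun (hL h) 1
    simp at h0 h1
    rw [h1, ← h0, one_mul]

/-- A sextic with isolated singularities contains no plane. -/
theorem exists_eval_plane_ne_zero {f : MvPolynomial (Fin 4) ℂ} (hf : f.IsHomogeneous 6)
    (hfin : (SingSet f).Finite) {L : (Fin 3 → ℂ) →ₗ[ℂ] (Fin 4 → ℂ)} (hL : Function.Injective L) :
    ∃ v, eval (L v) f ≠ 0 := by
  by_contra! hzero
  have hrange : Module.finrank ℂ (LinearMap.range L) = 3 := by
    rw [LinearMap.finrank_range_of_inj hL]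
    simp
  obtain ⟨n, hn⟩ : ∃ n, n ∉ LinearMap.range L := by
    by_contra! hall
    have htop : LinearMap.range L = ⊤ := eq_top_iff.2 fun x _ => hall x
    rw [htop, finrank_top] at hrange
    simp at hrange
  have htop : LinearMap.range L ⊔ Submodule.span ℂ {n} = ⊤ := by
    apply Submodule.eq_top_of_finrank_eq
    have hlt : LinearMap.range L < LinearMap.range L ⊔ Submodule.span ℂ {n} := by
      refine lt_of_le_of_ne le_sup_left fun heq => hn ?_
      rw [heq]
      exact Submodule.mem_sup_right (Submodule.mem_span_singleton_self n)
    have h1 := Submodule.finrank_lt_finrank_of_lt hlt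
    have h2 := Submodule.finrank_le (LinearMap.range L ⊔ Submodule.span ℂ {n})
    simp only [Module.finrank_fintype_fun_eq_card, Fintype.card_fin] at h2 ⊢
    omega
  let g : MvPolynomial (Fin 4) ℂ := ∑ i, C (n i) * pderiv i f
  have hg : g.IsHomogeneous 5 := IsHomogeneous.sum _ _ _ fun i _ => (hf.pderiv (i := i)).C_mul _
  have htangent : ∀ v x, ∑ i, eval (L v) (pderiv i f) * L x i = 0 := by
    intro v x
    let γ : Fin 4 → Polynomial ℂ := fun i =>
      Polynomial.C (L v i) + Polynomial.X * Polynomial.C (L x i)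
    have h0 : aeval γ f = 0 := by
      refine Polynomial.funext fun s => ?_
      rw [eval_aeval_polynomial, Polynomial.eval_zero, ← hzero (v + s • x)]
      congr 2
      funext i
      simp [γ]
      ring
    have h1 := derivation_aeval Polynomial.derivative' γ f
    rw [h0, map_zero] at h1
    have h2 := congrArg (Polynomial.eval 0) h1
    simpa [Polynomial.eval_finsetSum, eval_aeval_polynomial, γ] using h2.symm
  have hsing : ∀ v, eval (L v) g = 0 → SingularAt f (L v) := by
    intro v hv
    let φ : (Fin 4 → ℂ) →ₗ[ℂ] ℂ := Fintype.linearCombination ℂ fun i => eval (L v) (pderiv i f)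
    have hφ : ∀ x, φ x = ∑ i, x i * eval (L v) (pderiv i f) := fun x => by
      simp [φ, Fintype.linearCombination_apply]
    have hker : (⊤ : Submodule ℂ (Fin 4 → ℂ)) ≤ LinearMap.ker φ := by
      rw [← htop, sup_le_iff, Submodule.span_singleton_le_iff_mem]
      constructor
      · rintro _ ⟨x, rfl⟩
        rw [LinearMap.mem_ker, hφ, ← htangent v x]
        exact Finset.sum_congr rfl fun i _ => mul_comm _ _
      · rw [LinearMap.mem_ker, hφ]
        simpa [g] using hv
    refine multAtLeast_succ_iff.2 ⟨hzero v, fun i => multAtLeast_succ_iff.2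
      ⟨?_, fun _ => multAtLeast_zero _ _⟩⟩
    have := LinearMap.mem_ker.1 (hker (Submodule.mem_top (x := Pi.single i 1)))
    simpa [hφ, Pi.single_apply] using this
  by_cases hcase : ∃ s : ℂ, eval (L ![s, 0, 1]) g ≠ 0
  · obtain ⟨s₀, hs₀⟩ := hcase
    have hroot : ∀ t : ℂ, ∃ r : ℂ, eval (L ![1 + r * s₀, t, r]) g = 0 := by
      intro t
      obtain ⟨r, hr⟩ := hg.exists_zero_on_line (by norm_num) (L ![1, t, 0]) _ hs₀
      refine ⟨r, ?_⟩
      rw [← map_smul, ← map_add] at hr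
      simpa using hr
    choose r hr using hroot
    refine not_singular_family hf hfin (fun t => L ![1 + r t * s₀, t, r t]) (fun s hs => ?_)
      (fun s t k h => ?_) fun s => hsing _ (hr s)
    · have h := hL (hs.trans (map_zero L).symm)
      have h0 := congrFun h 0
      have h2 := congrFun h 2
      simp at h0 h2
      simp [h2] at h0
    · simp only [← map_smul] at h
      have h0 := congrFun (hL h) 0
      have h1 := congrFun (hL h) 1
      have h2 := congrFun (hL h) 2
      simp at h0 h1 h2
      have hk : k = 1 := by linear_combination -h0 + s₀ * h2
      rw [h1, hk, one_mul]
  · push Not at hcase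
    refine not_singular_family hf hfin (fun t => L ![t, 0, 1]) (fun s hs => ?_)
      (fun s t k h => ?_) fun s => hsing _ (hcase s)
    · have h2 := congrFun (hL (hs.trans (map_zero L).symm)) 2
      simp at h2
    · simp only [← map_smul] at h
      have h0 := congrFun (hL h) 0
      have h2 := congrFun (hL h) 2
      simp at h0 h2
      rw [h0, ← h2, one_mul]


/-- The linear parametrization of the plane spanned by three vectors. -/
def planeMap (a b c : Fin 4 → ℂ) : (Fin 3 → ℂ) →ₗ[ℂ] (Fin 4 → ℂ) :=
  Fintype.linearCombination ℂ ![a, b, c]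

theorem planeMap_apply (a b c : Fin 4 → ℂ) (v : Fin 3 → ℂ) :
    planeMap a b c v = v 0 • a + v 1 • b + v 2 • c := by
  simp [planeMap, Fintype.linearCombination_apply, Fin.sum_univ_three]

theorem planeMap_injective {a b c : Fin 4 → ℂ} (h : LinearIndependent ℂ ![a, b, c]) :
    Function.Injective (planeMap a b c) :=
  h.fintypeLinearCombination_injective

/-- Three distinct triple points of a sextic with isolated singularities that lie in a plane are
not collinear. -/
theorem triple_points_general {f : MvPolynomial (Fin 4) ℂ} (hf : f.IsHomogeneous 6)
    (hfin : (SingSet f).Finite) {L : (Fin 3 → ℂ) →ₗ[ℂ] (Fin 4 → ℂ)} (hL : Function.Injective L)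
    {ι : Type*} {w : ι → Fin 3 → ℂ} (hw0 : ∀ i, w i ≠ 0)
    (hw : ∀ i j, i ≠ j → ∀ r : ℂ, w i ≠ r • w j) (hm : ∀ i, MultAtLeast f (L (w i)) 3)
    {i j k : ι} (hij : i ≠ j) (hik : i ≠ k) (hjk : j ≠ k) {α β γ : ℂ}
    (h : α • w i + β • w j + γ • w k = 0) : α = 0 ∧ β = 0 ∧ γ = 0 := by
  have hpair : ∀ i j, i ≠ j → ∀ r s : ℂ, r • w i + s • w j = 0 → r = 0 ∧ s = 0 := by
    intro i j hij r s hrs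
    have hr : r = 0 := by
      by_contra hr
      apply hw i j hij (-s / r)
      apply smul_right_injective _ hr
      simp only [smul_smul, mul_div_cancel₀ _ hr]
      linear_combination (norm := module) hrs
    subst hr
    rw [zero_smul, zero_add] at hrs
    exact ⟨rfl, (smul_eq_zero.1 hrs).resolve_right (hw0 j)⟩
  by_cases hγ : γ = 0
  · subst hγ
    rw [zero_smul, add_zero] at h
    obtain ⟨h1, h2⟩ := hpair i j hij _ _ h
    exact ⟨h1, h2, rfl⟩
  exfalso
  have hα : α ≠ 0 := by
    rintro rfl
    rw [zero_smul, zero_add] at h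
    exact hγ (hpair j k hjk _ _ h).2
  have hβ : β ≠ 0 := by
    rintro rfl
    rw [zero_smul, add_zero] at h
    exact hγ (hpair i k hik _ _ h).2
  have hk : w k = (-α / γ) • w i + (-β / γ) • w j := by
    apply smul_right_injective _ hγ
    simp only [smul_add, smul_smul, mul_div_cancel₀ _ hγ]
    linear_combination (norm := module) h
  refine no_three_collinear hf hfin (p₁ := L (w i)) (p₂ := L (w j)) (fun r s hrs => ?_)
    (div_ne_zero (neg_ne_zero.2 hα) hγ) (div_ne_zero (neg_ne_zero.2 hβ) hγ) ?_ (hm i) (hm j) (hm k)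
  · refine hpair i j hij r s (hL ?_)
    rw [map_add, map_smul, map_smul, hrs, map_zero]
  · rw [hk, map_add, map_smul, map_smul]

theorem linearMap_mulVec_injective {L : (Fin 3 → ℂ) →ₗ[ℂ] (Fin 4 → ℂ)}
    (hL : Function.Injective L) {T : Matrix (Fin 3) (Fin 3) ℂ} (hT : T.det ≠ 0) :
    Function.Injective (L ∘ₗ T.mulVecLin) := by
  rw [LinearMap.coe_comp]
  refine hL.comp ?_
  rw [Matrix.coe_mulVecLin, Matrix.mulVec_injective_iff_isUnit]
  exact (Matrix.isUnit_iff_isUnit_det T).2 (isUnit_iff_ne_zero.2 hT)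

/-- A sextic with five triple points on a smooth plane conic cuts the plane in three times the
conic. -/
theorem eval_eq_of_five_on_conic {f : MvPolynomial (Fin 4) ℂ} (hf : f.IsHomogeneous 6)
    (hfin : (SingSet f).Finite) {L : (Fin 3 → ℂ) →ₗ[ℂ] (Fin 4 → ℂ)} (hL : Function.Injective L)
    {t : Fin 5 → ℂ} (ht : Function.Injective t)
    (h : ∀ j, MultAtLeast f (L ![1, t j, t j ^ 2]) 3) :
    ∃ r : ℂ, r ≠ 0 ∧ ∀ v, eval (L v) f = r * (v 1 ^ 2 - v 0 * v 2) ^ 3 := by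
  let g : Fin 4 → MvPolynomial (Fin 3) ℂ := fun i => ∑ j, C (L (Pi.single j 1) i) * X j
  have hg : ∀ v, (fun i => eval v (g i)) = L v := by
    intro v
    funext i
    conv_rhs => rw [pi_eq_sum_univ' v]
    simp only [g, map_sum, map_mul, eval_C, eval_X, map_smul, Finset.sum_apply, Pi.smul_apply,
      smul_eq_mul]
    exact Finset.sum_congr rfl fun j _ => mul_comm _ _
  have heval : ∀ v, eval v (aeval g f) = eval (L v) f := by
    intro v
    rw [← hg, ← coe_aeval_eq_eval, RingHom.coe_coe, comp_aeval_apply, ← coe_aeval_eq_eval,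
      RingHom.coe_coe]
  have hgd : ∀ i j, pderiv j (g i) = C (L (Pi.single j 1) i) := by
    intro i j
    simp [g, pderiv_X, Pi.single_apply]
  have hghom : ∀ i, (g i).IsHomogeneous 1 := fun i =>
    IsHomogeneous.sum _ _ _ fun j _ => (isHomogeneous_X ℂ j).C_mul _
  obtain ⟨r, hr⟩ := eq_C_mul_stdConic_pow_three (F := aeval g f) (hf.aeval g hghom) ht
    (fun j => MultAtLeast.linearSubst g (fun j => L (Pi.single j 1)) hgd (by rw [hg]; exact h j))
  have hv : ∀ v, eval (L v) f = r * (v 1 ^ 2 - v 0 * v 2) ^ 3 := by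
    intro v
    rw [← heval, hr]
    simp [stdConic]
  refine ⟨r, ?_, hv⟩
  rintro rfl
  obtain ⟨v, hv0⟩ := exists_eval_plane_ne_zero hf hfin hL
  exact hv0 (by rw [hv, zero_mul])

/-- Five triple points in a plane lie on a smooth conic, three times which is the plane section. -/
theorem five_triple_points {f : MvPolynomial (Fin 4) ℂ} (hf : f.IsHomogeneous 6)
    (hfin : (SingSet f).Finite) {L : (Fin 3 → ℂ) →ₗ[ℂ] (Fin 4 → ℂ)} (hL : Function.Injective L)
    {w : Fin 5 → Fin 3 → ℂ} (hw0 : ∀ i, w i ≠ 0)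
    (hw : ∀ i j, i ≠ j → ∀ r : ℂ, w i ≠ r • w j) (hm : ∀ i, MultAtLeast f (L (w i)) 3)
    {z : Fin 3 → ℂ} (hz : z ≠ 0) :
    ∃ (T : Matrix (Fin 3) (Fin 3) ℂ) (t l : Fin 5 → ℂ), T.det ≠ 0 ∧ Function.Injective t ∧
      (∀ j, l j ≠ 0) ∧ (∀ j, w j = l j • T.mulVec ![1, t j, t j ^ 2]) ∧
      (∀ j, MultAtLeast f (L (T.mulVec ![1, t j, t j ^ 2])) 3) ∧
      (∀ r : ℂ, z ≠ r • T.mulVec ![0, 0, 1]) ∧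
      ∃ r : ℂ, r ≠ 0 ∧ ∀ v, eval (L (T.mulVec v)) f = r * (v 1 ^ 2 - v 0 * v 2) ^ 3 := by
  obtain ⟨T, t, l, hT, ht, hl, hwT, hzT⟩ := exists_conic_through_five w
    (fun i j k hij hik hjk α β γ h =>
      triple_points_general hf hfin hL hw0 hw hm hij hik hjk h) z hz
  have hmT : ∀ j, MultAtLeast f (L (T.mulVec ![1, t j, t j ^ 2])) 3 := by
    intro j
    have h := (hm j).smul hf (l j)⁻¹
    rwa [hwT, map_smul, inv_smul_smul₀ (hl j)] at h
  obtain ⟨r, hr, hv⟩ := eval_eq_of_five_on_conic hf hfin (linearMap_mulVec_injective hL hT) ht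
    (fun j => by rw [LinearMap.comp_apply, Matrix.mulVecLin_apply]; exact hmT j)
  refine ⟨T, t, l, hT, ht, hl, hwT, hmT, hzT, r, hr, fun v => ?_⟩
  rw [← hv, LinearMap.comp_apply, Matrix.mulVecLin_apply]

/-- A plane contains at most five triple points of a sextic with isolated singularities. -/
theorem no_six_triple_points {f : MvPolynomial (Fin 4) ℂ} (hf : f.IsHomogeneous 6)
    (hfin : (SingSet f).Finite) {L : (Fin 3 → ℂ) →ₗ[ℂ] (Fin 4 → ℂ)} (hL : Function.Injective L)
    {w : Fin 6 → Fin 3 → ℂ} (hw0 : ∀ i, w i ≠ 0)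
    (hw : ∀ i j, i ≠ j → ∀ r : ℂ, w i ≠ r • w j) (hm : ∀ i, MultAtLeast f (L (w i)) 3) :
    False := by
  obtain ⟨T, t, l, hT, ht, hl, hwT, hmT, hzT, r, hr, hv⟩ :=
    five_triple_points hf hfin hL (w := fun i => w i.castSucc) (fun i => hw0 _)
      (fun i j hij => hw _ _ ((Fin.castSucc_injective 5).ne hij)) (fun i => hm _)
      (hw0 (Fin.last 5))
  have hTu : IsUnit T.det := isUnit_iff_ne_zero.2 hT
  obtain ⟨y, hy⟩ : ∃ y, w (Fin.last 5) = T.mulVec y :=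
    ⟨T⁻¹.mulVec (w (Fin.last 5)), by
      rw [Matrix.mulVec_mulVec, Matrix.mul_nonsing_inv _ hTu, Matrix.one_mulVec]⟩
  have hconic : y 1 ^ 2 - y 0 * y 2 = 0 := by
    have h := (hm (Fin.last 5)).eval_eq_zero
    rw [hy, hv] at h
    exact pow_eq_zero_iff (by norm_num) |>.1 ((mul_eq_zero.1 h).resolve_left hr)
  have hy0 : y 0 ≠ 0 := by
    intro h0
    have h1 : y 1 = 0 := by
      rw [h0, zero_mul, sub_zero] at hconic
      exact pow_eq_zero_iff (by norm_num) |>.1 hconic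
    apply hzT (y 2)
    rw [hy, ← Matrix.mulVec_smul]
    congr 1
    funext i
    fin_cases i <;> simp [h0, h1]
  obtain ⟨s, hs⟩ : ∃ s, y = y 0 • ![1, s, s ^ 2] := by
    refine ⟨y 1 / y 0, ?_⟩
    funext i
    fin_cases i
    · simp
    · simp [mul_div_cancel₀ _ hy0]
    · simp only [Fin.reduceFinMk, Pi.smul_apply, Matrix.cons_val, smul_eq_mul]
      field_simp
      linear_combination -hconic
  have hws : w (Fin.last 5) = y 0 • T.mulVec ![1, s, s ^ 2] := by
    rw [← Matrix.mulVec_smul, ← hs, hy]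
  have hst : ∀ j, s ≠ t j := by
    rintro j rfl
    apply hw (Fin.last 5) j.castSucc (Fin.castSucc_lt_last j).ne' (y 0 / l j)
    rw [hws, hwT j, smul_smul, div_mul_cancel₀ _ (hl j)]
  refine no_six_on_conic hf hfin (linearMap_mulVec_injective hL hT)
    (t := Fin.snoc t s) (Fin.snoc_injective_iff.2 ⟨ht, ?_⟩) fun j => ?_
  · rintro ⟨j, hj⟩
    exact hst j hj.symm
  · refine Fin.lastCases ?_ (fun j => ?_) j
    · have h := (hm (Fin.last 5)).smul hf (y 0)⁻¹
      rw [hws, map_smul, inv_smul_smul₀ hy0] at h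
      rwa [Fin.snoc_last, LinearMap.comp_apply, Matrix.mulVecLin_apply]
    · rw [Fin.snoc_castSucc, LinearMap.comp_apply, Matrix.mulVecLin_apply]
      exact hmT j

/-- The symmetric matrix of the quadratic form `v ↦ v₁² - v₀ v₂`. -/
def stdConicMatrix : Matrix (Fin 3) (Fin 3) ℂ := !![0, 0, -1 / 2; 0, 1, 0; -1 / 2, 0, 0]

theorem eval_quadratic (M : Matrix (Fin 3) (Fin 3) ℂ) (v : Fin 3 → ℂ) :
    eval v (∑ i, ∑ j, C (M i j) * X i * X j) = v ⬝ᵥ M.mulVec v := by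
  simp only [map_sum, map_mul, eval_C, eval_X, dotProduct, Matrix.mulVec, Finset.mul_sum]
  exact Finset.sum_congr rfl fun i _ => Finset.sum_congr rfl fun j _ => by ring

theorem stdConicMatrix_dotProduct (v : Fin 3 → ℂ) :
    v ⬝ᵥ stdConicMatrix.mulVec v = v 1 ^ 2 - v 0 * v 2 := by
  simp [stdConicMatrix, Matrix.mulVec, dotProduct, Fin.sum_univ_three]
  ring

theorem stdConicMatrix_det_ne_zero : stdConicMatrix.det ≠ 0 := by
  rw [stdConicMatrix, Matrix.det_fin_three]
  simp [Matrix.cons_val]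

theorem eval_restrictPlane (a b c : Fin 4 → ℂ) (f : MvPolynomial (Fin 4) ℂ) (v : Fin 3 → ℂ) :
    eval v (restrictPlane a b c f) = eval (planeMap a b c v) f := by
  rw [restrictPlane, ← coe_aeval_eq_eval, RingHom.coe_coe, comp_aeval_apply, ← coe_aeval_eq_eval,
    RingHom.coe_coe]
  congr 2
  funext i
  simp [planeMap_apply, mul_comm]

/-- A sextic surface whose only singularities are ordinary triple points
has at most five triple points in any plane `H`; and if a plane contains five triple
points, then the restriction of `f` to `H` is `λ q³` for a nondegenerate quadratic form
`q` vanishing at the five points, so `H·X = 3C` for a smooth conic `C`. -/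
theorem sextic_plane_sections
    (f : MvPolynomial (Fin 4) ℂ) (hf : f ≠ 0) (hhom : f.IsHomogeneous 6)
    (hfin : (SingSet f).Finite)
    (htriple : ∀ P ∈ SingSet f, OrdinaryTriplePointAt 6 f P.rep)
    (a b c : Fin 4 → ℂ) (habc : LinearIndependent ℂ ![a, b, c]) :
    (∀ (k : ℕ) (w : Fin k → (Fin 3 → ℂ)),
      (∀ i, w i ≠ 0) →
      (∀ i j : Fin k, i ≠ j → ∀ cc : ℂ, w i ≠ cc • w j) →
      (∀ i, OrdinaryTriplePointAt 6 f (w i 0 • a + w i 1 • b + w i 2 • c)) →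
      k ≤ 5) ∧
    (∀ w : Fin 5 → (Fin 3 → ℂ),
      (∀ i, w i ≠ 0) →
      (∀ i j : Fin 5, i ≠ j → ∀ cc : ℂ, w i ≠ cc • w j) →
      (∀ i, OrdinaryTriplePointAt 6 f (w i 0 • a + w i 1 • b + w i 2 • c)) →
      ∃ (lam : ℂ) (q : MvPolynomial (Fin 3) ℂ) (M : Matrix (Fin 3) (Fin 3) ℂ),
        lam ≠ 0 ∧ M.IsSymm ∧ M.rank = 3 ∧
        q = ∑ i, ∑ j, MvPolynomial.C (M i j) * MvPolynomial.X i * MvPolynomial.X j ∧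
        (∀ i, MvPolynomial.eval (w i) q = 0) ∧
        restrictPlane a b c f = MvPolynomial.C lam * q ^ 3) := by
  have hL := planeMap_injective habc
  refine ⟨fun k w hw0 hw hm => ?_, fun w hw0 hw hm => ?_⟩
  · by_contra! hk
    have hk' : 6 ≤ k := hk
    refine no_six_triple_points hhom hfin hL (w := fun i => w (Fin.castLE hk' i)) (fun i => hw0 _)
      (fun i j hij => hw _ _ ((Fin.castLE_injective hk').ne hij)) fun i => ?_
    rw [planeMap_apply]
    exact (hm _).1
  · obtain ⟨T, t, l, hT, -, -, hwT, -, -, r, hr, hv⟩ := five_triple_points hhom hfin hL hw0 hw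
      (fun i => by rw [planeMap_apply]; exact (hm i).1) (hw0 0)
    have hTu : IsUnit T.det := isUnit_iff_ne_zero.2 hT
    have hq : ∀ v, eval v (∑ i, ∑ j, C ((T⁻¹.transpose * stdConicMatrix * T⁻¹) i j) * X i * X j) =
        T⁻¹.mulVec v 1 ^ 2 - T⁻¹.mulVec v 0 * T⁻¹.mulVec v 2 := by
      intro v
      rw [eval_quadratic, ← stdConicMatrix_dotProduct, ← Matrix.mulVec_mulVec,
        ← Matrix.mulVec_mulVec, Matrix.dotProduct_mulVec, Matrix.vecMul_transpose]
    refine ⟨r, _, T⁻¹.transpose * stdConicMatrix * T⁻¹, hr, ?_, ?_, rfl, fun i => ?_, ?_⟩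
    · have hS : stdConicMatrix.transpose = stdConicMatrix := by
        ext i j
        fin_cases i <;> fin_cases j <;> simp [stdConicMatrix]
      rw [Matrix.IsSymm, Matrix.transpose_mul, Matrix.transpose_mul, Matrix.transpose_transpose,
        hS, Matrix.mul_assoc]
    · have hN : T⁻¹.det ≠ 0 := by
        rw [Matrix.det_nonsing_inv, Ring.inverse_eq_inv']
        exact inv_ne_zero hT
      rw [Matrix.rank_of_isUnit, Fintype.card_fin]
      rw [Matrix.isUnit_iff_isUnit_det, isUnit_iff_ne_zero, Matrix.det_mul, Matrix.det_mul,
        Matrix.det_transpose]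
      exact mul_ne_zero (mul_ne_zero hN stdConicMatrix_det_ne_zero) hN
    · rw [hq, hwT, Matrix.mulVec_smul, Matrix.mulVec_mulVec, Matrix.nonsing_inv_mul _ hTu,
        Matrix.one_mulVec]
      simp
      ring
    · refine MvPolynomial.funext fun v => ?_
      rw [eval_restrictPlane, map_mul, map_pow, hq, eval_C, ← hv, Matrix.mulVec_mulVec,
        Matrix.mul_nonsing_inv _ hTu, Matrix.one_mulVec]
end
end

section
/- Let X = {f = 0} ⊂ ℙ³(ℂ) be a surface of degree 6 whose only singularities are ordinary triple points, and let H₁ ≠ H₂ be two distinct planes, each containing five triple points of X, so that the restriction of f to Hᵢ equals λᵢ qᵢ³ for a conic Cᵢ = {qᵢ = 0} ⊂ Hᵢ (i = 1, 2). Then C₁ and C₂ intersect in exactly two distinct points, and both intersection points are triple points of X. -/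
open MvPolynomial

noncomputable section

/-- The conic `{q = 0}` inside the plane of `ℙ³(ℂ)` spanned by `a`, `b`, `c`,
as a set of points of `ℙ³(ℂ)`. -/
def conicInPlane (a b c : Fin 4 → ℂ) (q : MvPolynomial (Fin 3) ℂ) :
    Set (Projectivization ℂ (Fin 4 → ℂ)) :=
  {P | ∃ u v w : ℂ, P.rep = u • a + v • b + w • c ∧
    MvPolynomial.eval ![u, v, w] q = 0}


open Module

theorem eval_aeval_eq {σ τ : Type*} (x : τ → ℂ) (g : σ → MvPolynomial τ ℂ)
    (f : MvPolynomial σ ℂ) :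
    eval x (aeval g f) = eval (fun i => eval x (g i)) f := by
  induction f using MvPolynomial.induction_on <;> simp_all

theorem eval_smul_of_isHomogeneous {σ : Type*} {q : MvPolynomial σ ℂ} {m : ℕ}
    (hq : q.IsHomogeneous m) (t : ℂ) (x : σ → ℂ) : eval (t • x) q = t ^ m * eval x q := by
  rw [eval_eq, eval_eq, Finset.mul_sum]
  refine Finset.sum_congr rfl fun d hd => ?_
  have h : d.degree = m := by
    rw [Finsupp.degree_eq_weight_one]
    exact hq (mem_support_iff.mp hd)
  simp only [Pi.smul_apply, smul_eq_mul, mul_pow, Finset.prod_mul_distrib,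
    Finset.prod_pow_eq_pow_sum, ← h, Finsupp.degree_apply]
  ring

/-- The derivative of a polynomial function along a line. -/
theorem hasDerivAt_eval_line {n : ℕ} (f : MvPolynomial (Fin n) ℂ) (p v : Fin n → ℂ) :
    HasDerivAt (fun t : ℂ => eval (p + t • v) f) (∑ i, v i * eval p (pderiv i f)) 0 := by
  induction f using MvPolynomial.induction_on with
  | C a => simpa using hasDerivAt_const (0 : ℂ) a
  | add f g hf hg =>
    simpa [mul_add, Finset.sum_add_distrib] using hf.fun_add hg
  | mul_X f j hf =>
    have hj : HasDerivAt (fun t : ℂ => p j + t * v j) (v j) 0 := by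
      simpa using ((hasDerivAt_id (0 : ℂ)).mul_const (v j)).const_add (p j)
    have h := hf.fun_mul hj
    simp only [zero_smul, add_zero, zero_mul] at h
    have e : (∑ i, v i * eval p (pderiv i (f * X j))) =
        (∑ i, v i * eval p (pderiv i f)) * p j + eval p f * v j := by
      simp only [Derivation.leibniz, pderiv_X, smul_eq_mul, map_add, map_mul, eval_X, mul_add,
        Finset.sum_add_distrib, Finset.sum_mul, Pi.single_apply, apply_ite (eval p), 
        map_zero, mul_ite, mul_one, mul_zero]
      simp
      rw [add_comm, mul_comm (v j)]
      congr 1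
      exact Finset.sum_congr rfl fun i _ => by ring
    rw [e]
    simpa using h

/-- A quadratic form in finitely many variables comes from a symmetric bilinear form. -/
theorem exists_bilinForm_of_isHomogeneous_two {n : ℕ} {q : MvPolynomial (Fin n) ℂ}
    (hq : q.IsHomogeneous 2) :
    ∃ β : LinearMap.BilinForm ℂ (Fin n → ℂ), (∀ x y, β x y = β y x) ∧
      ∀ x, β x x = eval x q := by
  refine ⟨Matrix.toBilin' (Matrix.of fun i j => 2⁻¹ * eval 0 (pderiv j (pderiv i q))), fun x y => ?_,
    fun x => ?_⟩
  · simp only [Matrix.toBilin'_apply, Matrix.of_apply]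
    rw [Finset.sum_comm]
    refine Finset.sum_congr rfl fun i _ => Finset.sum_congr rfl fun j _ => ?_
    have : pderiv i (pderiv j q) = pderiv j (pderiv i q) := by
      have h : ⁅(pderiv i : Derivation ℂ (MvPolynomial (Fin n) ℂ) (MvPolynomial (Fin n) ℂ)),
          (pderiv j : Derivation ℂ (MvPolynomial (Fin n) ℂ) (MvPolynomial (Fin n) ℂ))⁆ = 0 := by
        apply derivation_ext
        intro k
        simp [Derivation.commutator_apply, pderiv_X, Pi.single_apply, apply_ite]
      have := congrArg (fun D => D q) h
      simpa [Derivation.commutator_apply, sub_eq_zero] using this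
    rw [this]; ring
  · have h0 : ∀ i j, eval x (pderiv j (pderiv i q)) = eval 0 (pderiv j (pderiv i q)) := by
      intro i j
      have h : (pderiv j (pderiv i q)).IsHomogeneous 0 := by simpa using hq.pderiv.pderiv
      rw [← totalDegree_zero_iff_isHomogeneous, totalDegree_eq_zero_iff_eq_C] at h
      rw [h]; simp
    have h1 : ∀ i, ∑ j, x j * eval x (pderiv j (pderiv i q)) = eval x (pderiv i q) := by
      intro i
      have h : (pderiv i q).IsHomogeneous 1 := by simpa using hq.pderiv (i := i)
      simpa using congrArg (eval x) h.sum_X_mul_pderiv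
    have h2 : ∑ j, x j * eval x (pderiv j q) = 2 * eval x q := by
      simpa using congrArg (eval x) hq.sum_X_mul_pderiv
    rw [Matrix.toBilin'_apply, ← mul_right_inj' (two_ne_zero' ℂ), ← h2, Finset.mul_sum]
    refine Finset.sum_congr rfl fun i _ => ?_
    rw [← h1, Finset.mul_sum, Finset.mul_sum]
    refine Finset.sum_congr rfl fun j _ => ?_
    rw [h0, Matrix.of_apply]; ring

theorem coeff_eq_zero_of_forall_sum_eq_zero {n : ℕ} (c : ℕ → ℂ)
    (h : ∀ t : ℂ, ∑ j ∈ Finset.range n, t ^ j * c j = 0) {j : ℕ} (hj : j < n) : c j = 0 := by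
  have h0 : ∑ j ∈ Finset.range n, Polynomial.C (c j) * Polynomial.X ^ j = 0 := by
    apply Polynomial.funext
    intro t
    rw [Polynomial.eval_finsetSum, Polynomial.eval_zero, ← h t]
    refine Finset.sum_congr rfl fun j _ => ?_
    rw [Polynomial.eval_mul, Polynomial.eval_C, Polynomial.eval_pow, Polynomial.eval_X, mul_comm]
  have := congrArg (fun r => Polynomial.coeff r j) h0
  simpa [Polynomial.finsetSum_coeff, Polynomial.coeff_C_mul, Polynomial.coeff_X_pow, hj] using this

/-- The restriction of a sextic to a plane on which it is the cube of a conic, in terms of a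
bilinear form on the ambient space. -/
theorem exists_bilinForm_of_restrictPlane {f : MvPolynomial (Fin 4) ℂ} {a b c : Fin 4 → ℂ}
    (h : LinearIndependent ℂ ![a, b, c]) {lam : ℂ} {q : MvPolynomial (Fin 3) ℂ}
    (hq : q.IsHomogeneous 2) (hr : restrictPlane a b c f = C lam * q ^ 3) :
    ∃ β : LinearMap.BilinForm ℂ (Fin 4 → ℂ), (∀ x y, β x y = β y x) ∧
      (∀ x ∈ Submodule.span ℂ {a, b, c}, eval x f = lam * β x x ^ 3) ∧
      conicInPlane a b c q = {P | P.rep ∈ Submodule.span ℂ {a, b, c} ∧ β P.rep P.rep = 0} := by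
  obtain ⟨γ, hγs, hγ⟩ := exists_bilinForm_of_isHomogeneous_two hq
  let φ : (Fin 3 → ℂ) →ₗ[ℂ] (Fin 4 → ℂ) := Fintype.linearCombination ℂ ![a, b, c]
  have hφ : ∀ x, φ x = x 0 • a + x 1 • b + x 2 • c := fun x => by
    simp [φ, Fintype.linearCombination_apply, Fin.sum_univ_three]
  have hker : LinearMap.ker φ = ⊥ := by
    rw [LinearMap.ker_eq_bot]
    exact linearIndependent_iff_injective_fintypeLinearCombination.mp h
  obtain ⟨ψ, hψ⟩ := φ.exists_leftInverse_of_injective hker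
  have hψ' : ∀ x, ψ (φ x) = x := fun x => LinearMap.congr_fun hψ x
  have hmem : ∀ z, z ∈ Submodule.span ℂ {a, b, c} ↔ ∃ x, z = φ x := by
    intro z
    rw [Submodule.mem_span_triple]
    constructor
    · rintro ⟨u, v, w, rfl⟩
      exact ⟨![u, v, w], by simp [hφ]⟩
    · rintro ⟨x, rfl⟩
      exact ⟨x 0, x 1, x 2, (hφ x).symm⟩
  have hval : ∀ x, eval (φ x) f = lam * eval x q ^ 3 := by
    intro x
    have := congrArg (eval x) hr
    rw [restrictPlane, eval_aeval_eq] at this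
    simp only [map_add, map_mul, eval_C, eval_X, map_pow] at this
    rw [← this, hφ]
    congr 2
    ext i
    simp [mul_comm]
  refine ⟨γ.compl₁₂ ψ ψ, fun x y => hγs _ _, ?_, ?_⟩
  · intro z hz
    obtain ⟨x, rfl⟩ := (hmem z).mp hz
    simp [hψ', hγ, hval]
  · ext P
    simp only [conicInPlane, Set.mem_ofPred_eq]
    constructor
    · rintro ⟨u, v, w, hP, h0⟩
      have hP' : P.rep = φ ![u, v, w] := by simp [hφ, hP]
      refine ⟨(hmem _).mpr ⟨_, hP'⟩, ?_⟩
      rw [hP']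
      simpa [hψ', hγ] using h0
    · rintro ⟨hP, h0⟩
      obtain ⟨x, hx⟩ := (hmem _).mp hP
      refine ⟨x 0, x 1, x 2, by rw [hx, hφ], ?_⟩
      rw [hx] at h0
      have hxv : ![x 0, x 1, x 2] = x := by ext i; fin_cases i <;> rfl
      rw [hxv]
      simpa [hψ', hγ] using h0

/-- A sextic which is the cube of a conic on each of two planes spanning the space is singular at
the common points of the two conics. -/
theorem singularAt_of_cube_on_planes {f : MvPolynomial (Fin 4) ℂ}
    {H : Fin 2 → Submodule ℂ (Fin 4 → ℂ)} (hH : H 0 ⊔ H 1 = ⊤)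
    {β : Fin 2 → LinearMap.BilinForm ℂ (Fin 4 → ℂ)} (hs : ∀ k x y, β k x y = β k y x)
    {lam : Fin 2 → ℂ} (hf : ∀ k, ∀ x ∈ H k, eval x f = lam k * β k x x ^ 3)
    {p : Fin 4 → ℂ} (hp : ∀ k, p ∈ H k) (h0 : ∀ k, β k p p = 0) : SingularAt f p := by
  let D : (Fin 4 → ℂ) →ₗ[ℂ] ℂ :=
    Fintype.linearCombination ℂ (fun i => eval p (pderiv i f))
  have hD : ∀ v, D v = ∑ i, v i * eval p (pderiv i f) := fun v => by
    simp [D, Fintype.linearCombination_apply]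
  have hle : ∀ k, H k ≤ LinearMap.ker D := by
    intro k v hv
    rw [LinearMap.mem_ker, hD]
    refine (hasDerivAt_eval_line f p v).unique ?_
    have e : (fun t : ℂ => eval (p + t • v) f) =
        fun t => t ^ 3 * (lam k * (2 * β k p v + t * β k v v) ^ 3) := by
      funext t
      rw [hf k _ ((H k).add_mem (hp k) ((H k).smul_mem t hv))]
      simp only [map_add, map_smul, LinearMap.add_apply, LinearMap.smul_apply, smul_eq_mul, h0 k,
        hs k v p]
      ring
    rw [e]
    have h1 : DifferentiableAt ℂ
        (fun t : ℂ => lam k * (2 * β k p v + t * β k v v) ^ 3) 0 := by fun_prop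
    simpa using (hasDerivAt_pow 3 (0 : ℂ)).fun_mul h1.hasDerivAt
  have htop : LinearMap.ker D = ⊤ := top_le_iff.mp (hH ▸ sup_le (hle 0) (hle 1))
  intro l hl
  match l, hl with
  | [], _ => simp [pderivList, hf 0 p (hp 0), h0 0]
  | [i], _ =>
    have h : D (Pi.single i 1) = 0 := by
      rw [← LinearMap.mem_ker, htop]; trivial
    simpa [hD, Pi.single_apply, pderivList] using h
  | _ :: _ :: _, hl => simp at hl

/-- If a sextic is the cube of a conic on each of two planes spanning the space, and both conics
are tangent to the common line of the planes at `p`, then `p` is not an ordinary triple point. -/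
theorem not_ordinaryTriplePointAt_of_tangent {f : MvPolynomial (Fin 4) ℂ}
    {H : Fin 2 → Submodule ℂ (Fin 4 → ℂ)} (hH : H 0 ⊔ H 1 = ⊤)
    {β : Fin 2 → LinearMap.BilinForm ℂ (Fin 4 → ℂ)} (hs : ∀ k x y, β k x y = β k y x)
    {lam : Fin 2 → ℂ} (hf : ∀ k, ∀ x ∈ H k, eval x f = lam k * β k x x ^ 3)
    {p v : Fin 4 → ℂ} (hp : ∀ k, p ∈ H k) (h0 : ∀ k, β k p p = 0)
    (hv : ∀ k, v ∈ H k) (h1 : ∀ k, β k p v = 0) (hpv : ∀ s : ℂ, v ≠ s • p) :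
    ¬ OrdinaryTriplePointAt 6 f p := by
  rintro ⟨-, -, B, hB, hBp, g, hgh, hg, hns⟩
  let π : (Fin 4 → ℂ) →ₗ[ℂ] (Fin 3 → ℂ) := LinearMap.funLeft ℂ ℂ Fin.castSucc ∘ₗ B⁻¹.mulVecLin
  let ι : (Fin 3 → ℂ) →ₗ[ℂ] (Fin 4 → ℂ) := B.mulVecLin ∘ₗ
    LinearMap.pi ![LinearMap.proj 0, LinearMap.proj 1, LinearMap.proj 2, 0]
  have hι : ∀ y, ι y = B.mulVec ![y 0, y 1, y 2, 0] := by
    intro y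
    simp only [ι, LinearMap.comp_apply, Matrix.mulVecLin_apply]
    congr 1
    ext i
    fin_cases i <;> rfl
  have hπ : ∀ x, ∃ s : ℂ, ι (π x) = x - s • p := by
    intro x
    refine ⟨B⁻¹.mulVec x 3, ?_⟩
    have e : ![π x 0, π x 1, π x 2, 0] =
        B⁻¹.mulVec x - (B⁻¹.mulVec x 3) • ![0, 0, 0, 1] := by
      ext i
      fin_cases i <;> simp [π, LinearMap.funLeft_apply]
    rw [hι, e, Matrix.mulVec_sub, Matrix.mulVec_smul, hBp, Matrix.mulVec_mulVec,
      Matrix.mul_nonsing_inv _ hB, Matrix.one_mulVec]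
  have hπs : Function.Surjective π := by
    intro y
    refine ⟨ι y, ?_⟩
    ext i
    simp only [π, hι, LinearMap.comp_apply, LinearMap.funLeft_apply, Matrix.mulVecLin_apply,
      Matrix.mulVec_mulVec, Matrix.nonsing_inv_mul _ hB, Matrix.one_mulVec]
    fin_cases i <;> rfl
  have hexp : ∀ (t : ℂ) (y : Fin 3 → ℂ),
      eval (p + t • ι y) f = ∑ j ∈ Finset.range 7, t ^ j * eval y (g j) := by
    intro t y
    have e := congrArg (eval ![t * y 0, t * y 1, t * y 2, 1]) hg
    rw [substMatrix, eval_aeval_eq, map_sum] at e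
    have e1 : (fun i => eval ![t * y 0, t * y 1, t * y 2, 1] (∑ j, C (B i j) * X j)) =
        p + t • ι y := by
      rw [← hBp, hι, ← Matrix.mulVec_smul, ← Matrix.mulVec_add]
      ext i
      simp [Matrix.mulVec, dotProduct, Fin.sum_univ_four]
    rw [e1] at e
    rw [e]
    refine Finset.sum_congr rfl fun j _ => ?_
    have e2 : (![t * y 0, t * y 1, t * y 2, 1] : Fin 4 → ℂ) ∘ Fin.castSucc = t • y := by
      ext i
      fin_cases i <;> rfl
    rw [map_mul, map_pow, eval_X, eval_rename, e2, eval_smul_of_isHomogeneous (hgh j)]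
    simp
  obtain ⟨c, hc⟩ := hπ v
  have hy0 : π v ≠ 0 := by
    intro h
    rw [h, map_zero] at hc
    exact hpv c (sub_eq_zero.mp hc.symm)
  let D : (Fin 3 → ℂ) →ₗ[ℂ] ℂ :=
    Fintype.linearCombination ℂ (fun i => eval (π v) (pderiv i (g 3)))
  have hD : ∀ y, D y = ∑ i, y i * eval (π v) (pderiv i (g 3)) := fun v => by
    simp [D, Fintype.linearCombination_apply]
  have hle : ∀ k, H k ≤ LinearMap.ker (D ∘ₗ π) := by
    intro k e he
    rw [LinearMap.mem_ker, LinearMap.comp_apply, hD]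
    refine (hasDerivAt_eval_line (g 3) (π v) (π e)).unique ?_
    obtain ⟨d, hd⟩ := hπ e
    have hcube : (fun s : ℂ => eval (π v + s • π e) (g 3)) =
        fun s => s ^ 3 * (lam k * (2 * β k p e) ^ 3) := by
      funext s
      set w := v - c • p + s • (e - d • p) with hw
      have hιw : ι (π v + s • π e) = w := by rw [map_add, map_smul, hc, hd]
      have hwH : w ∈ H k :=
        (H k).add_mem ((H k).sub_mem (hv k) ((H k).smul_mem _ (hp k)))
          ((H k).smul_mem _ ((H k).sub_mem he ((H k).smul_mem _ (hp k))))
      have hpw : β k p w = s * β k p e := by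
        simp [hw, h0 k, h1 k]
      let a : ℕ → ℂ := fun j =>
        if j = 3 then lam k * (2 * (s * β k p e)) ^ 3
        else if j = 4 then lam k * (3 * (2 * (s * β k p e)) ^ 2 * β k w w)
        else if j = 5 then lam k * (3 * (2 * (s * β k p e)) * β k w w ^ 2)
        else if j = 6 then lam k * β k w w ^ 3 else 0
      have h3 := coeff_eq_zero_of_forall_sum_eq_zero (n := 7)
        (fun j => eval (π v + s • π e) (g j) - a j) (fun t => by
          simp only [mul_sub, Finset.sum_sub_distrib]
          rw [← hexp, hιw, hf k _ ((H k).add_mem (hp k) ((H k).smul_mem t hwH))]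
          simp only [map_add, map_smul, LinearMap.add_apply, LinearMap.smul_apply, smul_eq_mul,
            h0 k, hs k w p, hpw, Finset.sum_range_succ, Finset.sum_range_zero, a]
          norm_num
          ring) (j := 3) (by norm_num)
      have h3' := sub_eq_zero.mp h3
      rw [h3']
      simp only [a, if_true]
      ring
    rw [hcube]
    simpa using (hasDerivAt_pow 3 (0 : ℂ)).mul_const (lam k * (2 * β k p e) ^ 3)
  have htop : LinearMap.ker (D ∘ₗ π) = ⊤ := top_le_iff.mp (hH ▸ sup_le (hle 0) (hle 1))
  obtain ⟨i, hi⟩ := hns (π v) hy0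
  obtain ⟨x, hx⟩ := hπs (Pi.single i 1)
  have h : (D ∘ₗ π) x = 0 := by
    rw [← LinearMap.mem_ker, htop]; trivial
  rw [LinearMap.comp_apply, hx, hD] at h
  exact hi (by simpa [Pi.single_apply] using h)

/-- A quadratic form on a plane is either degenerate or has two independent isotropic vectors. -/
theorem degenerate_or_exists_isotropic_pair {V : Type*} [AddCommGroup V] [Module ℂ V]
    {β : LinearMap.BilinForm ℂ V} (hs : ∀ x y, β x y = β y x)
    {L : Submodule ℂ V} (hL : finrank ℂ L = 2) :
    (∃ p ∈ L, p ≠ 0 ∧ ∀ v ∈ L, β p v = 0) ∨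
      ∃ p ∈ L, ∃ p' ∈ L, β p p = 0 ∧ β p' p' = 0 ∧ β p p' ≠ 0 := by
  have hiso : ∃ p ∈ L, p ≠ 0 ∧ β p p = 0 := by
    have : FiniteDimensional ℂ L := .of_finrank_eq_succ hL
    let b : Basis (Fin 2) ℂ L := finBasisOfFinrankEq ℂ L hL
    by_cases h0 : β (b 0) (b 0) = 0
    · exact ⟨b 0, (b 0).2, by simpa using b.ne_zero 0, h0⟩
    · obtain ⟨s, hs'⟩ := IsAlgClosed.exists_pow_nat_eq
        ((β (b 0) (b 1)) ^ 2 - β (b 0) (b 0) * β (b 1) (b 1)) (n := 2) (by norm_num)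
      set t := (-β (b 0) (b 1) + s) / β (b 0) (b 0) with ht
      have ht' : t * β (b 0) (b 0) = -β (b 0) (b 1) + s := div_mul_cancel₀ _ h0
      refine ⟨(b 1 + t • b 0 : L), (b 1 + t • b 0 : L).2, ?_, ?_⟩
      · intro h
        have h' : b 1 + t • b 0 = 0 := by exact_mod_cast h
        have := congrArg (fun x => b.repr x 1) h'
        simp at this
      · refine mul_left_cancel₀ h0 ?_
        simp only [Submodule.coe_add, Submodule.coe_smul, map_add, map_smul, LinearMap.add_apply,
          LinearMap.smul_apply, smul_eq_mul, hs (b 1) (b 0), mul_zero]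
        linear_combination (t * β (b 0) (b 0) + β (b 0) (b 1) + s) * ht' + hs'
  obtain ⟨p, hpL, hp0, hpp⟩ := hiso
  by_cases h : ∀ v ∈ L, β p v = 0
  · exact .inl ⟨p, hpL, hp0, h⟩
  · push Not at h
    obtain ⟨v, hvL, hv⟩ := h
    refine .inr ⟨p, hpL, v - (β v v / (2 * β p v)) • p,
      L.sub_mem hvL (L.smul_mem _ hpL), hpp, ?_, ?_⟩
    · simp only [map_sub, map_smul, LinearMap.sub_apply, LinearMap.smul_apply, smul_eq_mul, hpp,
        hs v p]
      field_simp
      ring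
    · simpa [hpp] using hv

/-- A sum of two isotropic lines of a plane contains no further isotropic vectors. -/
theorem isotropic_eq_smul {V : Type*} [AddCommGroup V] [Module ℂ V]
    {β : LinearMap.BilinForm ℂ V} (hs : ∀ x y, β x y = β y x)
    {L : Submodule ℂ V} (hL : finrank ℂ L = 2) {p p' r : V} (hp : p ∈ L) (hp' : p' ∈ L)
    (h0 : β p p = 0) (h0' : β p' p' = 0) (h : β p p' ≠ 0) (hr : r ∈ L) (hrr : β r r = 0) :
    (∃ s : ℂ, r = s • p) ∨ ∃ s : ℂ, r = s • p' := by
  have hli : LinearIndependent ℂ ![p, p'] := by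
    rw [LinearIndependent.pair_iff]
    intro s t hst
    have h1 := congrArg (β p) hst
    have h2 := congrArg (β p') hst
    simp [h0, h0', h, hs p' p] at h1 h2
    exact ⟨h2, h1⟩
  have hspan : Submodule.span ℂ {p, p'} = L := by
    have : FiniteDimensional ℂ L := .of_finrank_eq_succ hL
    refine Submodule.eq_of_le_of_finrank_eq ?_ ?_
    · rw [Submodule.span_le]
      rintro x (rfl | rfl) <;> assumption
    · have := finrank_span_eq_card hli
      rw [hL, ← Matrix.range_cons_cons_empty p p' ![]]
      simpa using this
  rw [← hspan, Submodule.mem_span_pair] at hr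
  obtain ⟨s, t, rfl⟩ := hr
  have : s * t = 0 := by
    have e : 2 * β p p' * (s * t) = 0 := by
      rw [← hrr]
      simp only [map_add, map_smul, LinearMap.add_apply, LinearMap.smul_apply, smul_eq_mul, h0,
        h0', hs p' p]
      ring
    simpa [h] using e
  rcases mul_eq_zero.mp this with rfl | rfl
  · exact .inr ⟨t, by simp⟩
  · exact .inl ⟨s, by simp⟩

/-- Two conics whose cubes are proportional on a line are tangent to that line simultaneously. -/
theorem polar_eq_zero_of_cube_eq {V : Type*} [AddCommGroup V] [Module ℂ V]
    {β γ : LinearMap.BilinForm ℂ V} (hβ : ∀ x y, β x y = β y x) (hγ : ∀ x y, γ x y = γ y x)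
    {L : Submodule ℂ V} {lam mu : ℂ} (hmu : mu ≠ 0)
    (hcube : ∀ x ∈ L, lam * β x x ^ 3 = mu * γ x x ^ 3) {p v : V} (hp : p ∈ L) (hv : v ∈ L)
    (h0 : β p p = 0) (h0' : γ p p = 0) (h : β p v = 0) : γ p v = 0 := by
  let a : ℕ → ℂ := fun j =>
    if j = 3 then mu * (2 * γ p v) ^ 3
    else if j = 4 then mu * (3 * (2 * γ p v) ^ 2 * γ v v)
    else if j = 5 then mu * (3 * (2 * γ p v) * γ v v ^ 2)
    else if j = 6 then mu * γ v v ^ 3 - lam * β v v ^ 3 else 0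
  have h3 := coeff_eq_zero_of_forall_sum_eq_zero (n := 7) a (fun t => by
    have e := hcube _ (L.add_mem hp (L.smul_mem t hv))
    simp only [map_add, map_smul, LinearMap.add_apply, LinearMap.smul_apply, smul_eq_mul, h0, h0',
      h, hβ v p, hγ v p] at e
    simp only [Finset.sum_range_succ, Finset.sum_range_zero, a]
    norm_num
    linear_combination -e) (j := 3) (by norm_num)
  simpa [a, hmu] using h3

theorem finrank_span_triple {a b c : Fin 4 → ℂ} (h : LinearIndependent ℂ ![a, b, c]) :
    finrank ℂ (Submodule.span ℂ {a, b, c}) = 3 := by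
  have h3 := finrank_span_eq_card h
  rw [Matrix.range_cons, Matrix.range_cons_cons_empty] at h3
  exact h3

/-- Two different `(−1)`-conics of a sextic with only ordinary triple
points — conics `Cᵢ = {qᵢ = 0}` in distinct planes `Hᵢ` each containing five triple
points, with `f|_{Hᵢ} = λᵢ qᵢ³` — meet in exactly two distinct points, both of which
are triple points of the sextic. -/
theorem minus_one_conics_meet_in_two_triple_points
    (f : MvPolynomial (Fin 4) ℂ) (hf : f ≠ 0) (hhom : f.IsHomogeneous 6)
    (hfin : (SingSet f).Finite)
    (htriple : ∀ P ∈ SingSet f, OrdinaryTriplePointAt 6 f P.rep)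
    (a₁ b₁ c₁ a₂ b₂ c₂ : Fin 4 → ℂ)
    (h1 : LinearIndependent ℂ ![a₁, b₁, c₁])
    (h2 : LinearIndependent ℂ ![a₂, b₂, c₂])
    (hplanes : Submodule.span ℂ {a₁, b₁, c₁} ≠ Submodule.span ℂ {a₂, b₂, c₂})
    (w₁ w₂ : Fin 5 → (Fin 3 → ℂ))
    (hw₁ : ∀ i j : Fin 5, i ≠ j → ∀ cc : ℂ, w₁ i ≠ cc • w₁ j)
    (hw₂ : ∀ i j : Fin 5, i ≠ j → ∀ cc : ℂ, w₂ i ≠ cc • w₂ j)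
    (htp₁ : ∀ i, OrdinaryTriplePointAt 6 f (w₁ i 0 • a₁ + w₁ i 1 • b₁ + w₁ i 2 • c₁))
    (htp₂ : ∀ i, OrdinaryTriplePointAt 6 f (w₂ i 0 • a₂ + w₂ i 1 • b₂ + w₂ i 2 • c₂))
    (lam₁ lam₂ : ℂ) (hl₁ : lam₁ ≠ 0) (hl₂ : lam₂ ≠ 0)
    (q₁ q₂ : MvPolynomial (Fin 3) ℂ)
    (hq₁ : q₁.IsHomogeneous 2) (hq₂ : q₂.IsHomogeneous 2)
    (hr₁ : restrictPlane a₁ b₁ c₁ f = MvPolynomial.C lam₁ * q₁ ^ 3)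
    (hr₂ : restrictPlane a₂ b₂ c₂ f = MvPolynomial.C lam₂ * q₂ ^ 3) :
    ∃ P Q : Projectivization ℂ (Fin 4 → ℂ), P ≠ Q ∧
      conicInPlane a₁ b₁ c₁ q₁ ∩ conicInPlane a₂ b₂ c₂ q₂ = {P, Q} ∧
      OrdinaryTriplePointAt 6 f P.rep ∧ OrdinaryTriplePointAt 6 f Q.rep := by
  obtain ⟨β₁, hs₁, hf₁, hC₁⟩ := exists_bilinForm_of_restrictPlane h1 hq₁ hr₁
  obtain ⟨β₂, hs₂, hf₂, hC₂⟩ := exists_bilinForm_of_restrictPlane h2 hq₂ hr₂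
  have hd₁ := finrank_span_triple h1
  have hd₂ := finrank_span_triple h2
  set H₁ := Submodule.span ℂ {a₁, b₁, c₁}
  set H₂ := Submodule.span ℂ {a₂, b₂, c₂}
  have hlt : H₁ < H₁ ⊔ H₂ := by
    refine lt_of_le_of_ne le_sup_left fun h => hplanes ?_
    exact (Submodule.eq_of_le_of_finrank_eq (sup_eq_left.mp h.symm) (hd₂.trans hd₁.symm)).symm
  have hdim := Submodule.finrank_lt_finrank_of_lt hlt
  have hle := Submodule.finrank_le (H₁ ⊔ H₂)
  have hadd := Submodule.finrank_sup_add_finrank_inf_eq H₁ H₂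
  have h4 : finrank ℂ (Fin 4 → ℂ) = 4 := by simp
  have hsup : H₁ ⊔ H₂ = ⊤ := Submodule.eq_top_of_finrank_eq (by omega)
  have hL : finrank ℂ (H₁ ⊓ H₂ : Submodule ℂ (Fin 4 → ℂ)) = 2 := by omega
  have hcube : ∀ x ∈ H₁ ⊓ H₂, lam₁ * β₁ x x ^ 3 = lam₂ * β₂ x x ^ 3 := fun x hx => by
    rw [← hf₁ x hx.1, hf₂ x hx.2]
  have hiff : ∀ x ∈ H₁ ⊓ H₂, β₁ x x = 0 ↔ β₂ x x = 0 := by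
    intro x hx
    have := hcube x hx
    constructor <;> intro h <;> simpa [h, hl₁, hl₂] using this
  have hsing : ∀ p ∈ H₁ ⊓ H₂, β₁ p p = 0 → SingularAt f p := fun p hp h0 =>
    singularAt_of_cube_on_planes (H := ![H₁, H₂]) (β := ![β₁, β₂]) (lam := ![lam₁, lam₂]) hsup
      (Fin.forall_fin_two.mpr ⟨hs₁, hs₂⟩) (Fin.forall_fin_two.mpr ⟨hf₁, hf₂⟩)
      (Fin.forall_fin_two.mpr hp) (Fin.forall_fin_two.mpr ⟨h0, (hiff p hp).mp h0⟩)
  have hrep : ∀ (p : Fin 4 → ℂ) (hp0 : p ≠ 0), ∃ s : ℂ, s ≠ 0 ∧ s • p = (Projectivization.mk ℂ p hp0).rep := by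
    intro p hp0
    obtain ⟨s, hs⟩ := Projectivization.exists_smul_eq_mk_rep ℂ p hp0
    exact ⟨s, s.ne_zero, hs⟩
  have hinter : ∀ R, R ∈ conicInPlane a₁ b₁ c₁ q₁ ∩ conicInPlane a₂ b₂ c₂ q₂ ↔
      R.rep ∈ H₁ ⊓ H₂ ∧ β₁ R.rep R.rep = 0 := by
    intro R
    rw [hC₁, hC₂]
    constructor
    · rintro ⟨⟨h, h0⟩, h', -⟩
      exact ⟨⟨h, h'⟩, h0⟩
    · rintro ⟨h, h0⟩
      exact ⟨⟨h.1, h0⟩, h.2, (hiff _ h).mp h0⟩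
  have hmem : ∀ (p : Fin 4 → ℂ) (hp0 : p ≠ 0), p ∈ H₁ ⊓ H₂ → β₁ p p = 0 →
      Projectivization.mk ℂ p hp0 ∈ conicInPlane a₁ b₁ c₁ q₁ ∩ conicInPlane a₂ b₂ c₂ q₂ := by
    intro p hp0 hp h0
    obtain ⟨s, -, hs⟩ := hrep p hp0
    rw [hinter, ← hs]
    exact ⟨Submodule.smul_mem _ s hp, by simp [h0]⟩
  have htp : ∀ R ∈ conicInPlane a₁ b₁ c₁ q₁ ∩ conicInPlane a₂ b₂ c₂ q₂,
      OrdinaryTriplePointAt 6 f R.rep := fun R hR => by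
    obtain ⟨hRL, hR0⟩ := (hinter R).mp hR
    exact htriple R (hsing _ hRL hR0)
  rcases degenerate_or_exists_isotropic_pair hs₁ hL with
    ⟨p, hp, hp0, hdeg⟩ | ⟨p, hp, p', hp', h0, h0', hpp'⟩
  · exfalso
    have hP := hmem p hp0 hp (hdeg p hp)
    have hR := htp _ hP
    obtain ⟨hRL, hR0⟩ := (hinter _).mp hP
    obtain ⟨s, -, hs⟩ := hrep p hp0
    rw [← hs] at hR hRL hR0
    obtain ⟨v, hv, hvp⟩ : ∃ v ∈ H₁ ⊓ H₂, v ∉ Submodule.span ℂ {p} := by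
      rw [← SetLike.not_le_iff_exists]
      intro h
      have := Submodule.finrank_mono h
      rw [hL, finrank_span_singleton hp0] at this
      omega
    have h1v : β₁ (s • p) v = 0 := by simp [hdeg v hv]
    refine not_ordinaryTriplePointAt_of_tangent (H := ![H₁, H₂]) (β := ![β₁, β₂])
      (lam := ![lam₁, lam₂]) (p := s • p) (v := v) hsup
      (Fin.forall_fin_two.mpr ⟨hs₁, hs₂⟩) (Fin.forall_fin_two.mpr ⟨hf₁, hf₂⟩)
      (Fin.forall_fin_two.mpr hRL) (Fin.forall_fin_two.mpr ⟨hR0, (hiff _ hRL).mp hR0⟩)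
      (Fin.forall_fin_two.mpr hv) (Fin.forall_fin_two.mpr ⟨h1v, ?_⟩) (fun t ht => hvp ?_) hR
    · exact polar_eq_zero_of_cube_eq hs₁ hs₂ hl₂ hcube hRL hv hR0 ((hiff _ hRL).mp hR0) h1v
    · exact Submodule.mem_span_singleton.mpr ⟨t * s, by rw [ht, smul_smul]⟩
  · have hp0 : p ≠ 0 := by rintro rfl; simp at hpp'
    have hp0' : p' ≠ 0 := by rintro rfl; simp at hpp'
    have hP := hmem p hp0 hp h0
    have hQ := hmem p' hp0' hp' h0'
    refine ⟨Projectivization.mk ℂ p hp0, Projectivization.mk ℂ p' hp0', ?_, ?_, htp _ hP,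
      htp _ hQ⟩
    · rw [Ne, Projectivization.mk_eq_mk_iff']
      rintro ⟨s, hs⟩
      rw [← hs] at hpp'
      simp [h0'] at hpp'
    · ext R
      rw [Set.mem_insert_iff, Set.mem_singleton_iff]
      constructor
      · intro hR
        obtain ⟨hRL, hR0⟩ := (hinter R).mp hR
        rw [← R.mk_rep, Projectivization.mk_eq_mk_iff', Projectivization.mk_eq_mk_iff']
        exact (isotropic_eq_smul hs₁ hL hp hp' h0 h0' hpp' hRL hR0).imp
          (fun ⟨s, hs⟩ => ⟨s, hs.symm⟩) fun ⟨s, hs⟩ => ⟨s, hs.symm⟩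
      · rintro (rfl | rfl) <;> assumption
end
end
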